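/- (Châtelet's theorem) Let P be a Severi-Brauer variety of dimension n over a field k. Then P is isomorphic over k to projective n-space P^n_k if and only if P has a k-rational point. -/

import Mathlib

/-!
STATEMENT 4 (Châtelet's theorem; Kollár, Corollary 11 / `split.lem.cor.4`):

Let `P` be a Severi–Brauer variety of dimension `n` over a field `k`.  Then `P` is isomorphic
over `k` to projective `n`-space `ℙⁿ_k` if and only if `P` has a `k`-rational point.

Here a Severi–Brauer variety of dimension `n` over `k` is a proper `k`-scheme `P` such that
`P_{k̄} ≅ ℙⁿ_{k̄}` over `k̄`, where `k̄` is the algebraic closure of `k`; projective space is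
`ℙⁿ_R = Proj R[x₀,…,xₙ]`.
-/

noncomputable section
universe u
open AlgebraicGeometry CategoryTheory CategoryTheory.Limits

attribute [local instance] MvPolynomial.gradedAlgebra

/-- Projective `n`-space over `R`, as `Proj R[x_0,…,x_n]`. -/
def ProjectiveSpace (R : Type u) [CommRing R] (n : ℕ) : Scheme.{u} :=
  Proj (MvPolynomial.homogeneousSubmodule (Fin (n + 1)) R)

/-- The structure morphism `ℙⁿ_R ⟶ Spec R`. -/
def ProjectiveSpace.toSpec (R : Type u) [CommRing R] (n : ℕ) :
    ProjectiveSpace R n ⟶ Spec (CommRingCat.of R) :=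
  Proj.toSpecZero _ ≫ Spec.map (CommRingCat.ofHom
    (algebraMap R (MvPolynomial.homogeneousSubmodule (Fin (n + 1)) R 0)))

/-- Base change of an `k`-scheme along a ring homomorphism `k →+* K`. -/
def schemeBaseChange {k K : Type u} [CommRing k] [CommRing K] (f : k →+* K)
    {X : Scheme.{u}} (sX : X ⟶ Spec (CommRingCat.of k)) : Scheme.{u} :=
  pullback sX (Spec.map (CommRingCat.ofHom f))

def schemeBaseChange.toSpec {k K : Type u} [CommRing k] [CommRing K] (f : k →+* K)
    {X : Scheme.{u}} (sX : X ⟶ Spec (CommRingCat.of k)) :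
    schemeBaseChange f sX ⟶ Spec (CommRingCat.of K) :=
  pullback.snd _ _

/-- `P` (with structure morphism `sP`) is a Severi–Brauer variety of dimension `n` over `k`. -/
structure IsSeveriBrauer {k : Type u} [Field k] {P : Scheme.{u}}
    (sP : P ⟶ Spec (CommRingCat.of k)) (n : ℕ) : Prop where
  proper : IsProper sP
  exists_iso : ∃ e : schemeBaseChange (algebraMap k (AlgebraicClosure k)) sP ≅
      ProjectiveSpace (AlgebraicClosure k) n,
    e.hom ≫ ProjectiveSpace.toSpec (AlgebraicClosure k) n =
      schemeBaseChange.toSpec (algebraMap k (AlgebraicClosure k)) sP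

namespace Chatelet

section PolynomialVectorFields

open MvPolynomial

variable {κ F : Type*} [Field κ] [Field F] [Algebra κ F] {n : ℕ}

/-- `D` maps the image of `φ` into itself. -/
def Preserves {R : Type*} [CommRing R] (φ : R →+* F) (D : Derivation κ F F) : Prop :=
  ∀ a, ∃ b, D (φ a) = φ b

/-- `D` maps `R` into `I` and acts on `I / I ^ 2` as multiplication by the scalar `a`. -/
def ScalarAt {R : Type*} [CommRing R] (φ : R →+* F) (I : Ideal R) (D : Derivation κ F F)
    (a : κ) : Prop :=
  (∀ f, ∃ g ∈ I, D (φ f) = φ g) ∧ ∀ f ∈ I, ∃ g ∈ I ^ 2, D (φ f) - algebraMap κ F a * φ f = φ g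

/-- The affine coordinates `1, t_1, …, t_n`. -/
def homCoord (t : Fin n → F) : Fin (n + 1) → F := Fin.cons 1 t

/-- The coordinate ring of the `j`-th standard chart. -/
def chartRing (κ : Type*) [Field κ] [Algebra κ F] (t : Fin n → F) (j : Fin (n + 1)) :
    Subalgebra κ F :=
  Algebra.adjoin κ (Set.range fun i => homCoord t i / homCoord t j)

theorem exists_totalDegree_of_mem_chartRing {t : Fin n → F} (ht : ∀ i, t i ≠ 0) {j : Fin n} {x : F}
    (hx : x ∈ chartRing κ t j.succ) :
    ∃ (m : ℕ) (G : MvPolynomial (Fin n) κ), G.totalDegree ≤ m ∧ x * t j ^ m = aeval t G := by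
  have htj := ht j
  induction hx using Algebra.adjoin_induction with
  | mem x hx =>
    obtain ⟨i, rfl⟩ := hx
    refine Fin.cases ⟨1, 1, by simp, by simp [homCoord, htj]⟩ (fun i => ⟨1, X i, by simp, ?_⟩) i
    simp [homCoord, htj]
  | algebraMap r => exact ⟨0, C r, by simp, by simp⟩
  | add x y _ _ hx hy =>
    obtain ⟨m, G, hG, h⟩ := hx
    obtain ⟨m', G', hG', h'⟩ := hy
    refine ⟨m + m', G * X j ^ m' + G' * X j ^ m, ?_, ?_⟩
    · refine (totalDegree_add _ _).trans (max_le ?_ ?_)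
      · refine (totalDegree_mul _ _).trans (add_le_add hG (by simp))
      · rw [add_comm]; refine (totalDegree_mul _ _).trans (add_le_add hG' (by simp))
    · simp only [map_add, map_mul, map_pow, aeval_X, ← h, ← h']
      ring
  | mul x y _ _ hx hy =>
    obtain ⟨m, G, hG, h⟩ := hx
    obtain ⟨m', G', hG', h'⟩ := hy
    refine ⟨m + m', G * G', (totalDegree_mul _ _).trans (add_le_add hG hG'), ?_⟩
    simp only [map_mul, ← h, ← h']
    ring

theorem totalDegree_le_of_mem_chartRing {t : Fin n → F} (ht : AlgebraicIndependent κ t) {j : Fin n}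
    {g : MvPolynomial (Fin n) κ} (h : aeval t g / t j ^ 2 ∈ chartRing κ t j.succ) :
    g.totalDegree ≤ 2 := by
  obtain ⟨m, G, hG, h⟩ := exists_totalDegree_of_mem_chartRing (fun i => ht.ne_zero i) h
  have htj : t j ≠ 0 := ht.ne_zero j
  have h2 : g * X j ^ m = G * X j ^ 2 := by
    apply ht
    simp only [map_mul, map_pow, aeval_X, ← h]
    field_simp
  by_cases hg : g = 0
  · simp [hg]
  have hG0 : G ≠ 0 := by
    rintro rfl
    simp [hg, X_ne_zero] at h2
  have := congrArg totalDegree h2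
  rw [totalDegree_mul_of_isDomain hg (by simp [X_ne_zero]),
    totalDegree_mul_of_isDomain hG0 (by simp [X_ne_zero])] at this
  simp at this
  omega

theorem isHomogeneous_of_mem_pow {d : ℕ} {q : MvPolynomial (Fin n) κ}
    (hq : q ∈ idealOfVars (Fin n) κ ^ d) (hd : q.totalDegree ≤ d) : q.IsHomogeneous d := by
  intro m hm
  rw [mem_pow_idealOfVars_iff] at hq
  have h1 := hq m (mem_support_iff.mpr hm)
  have h2 := le_totalDegree (mem_support_iff.mpr hm)
  have h3 : m.degree = m.sum fun _ e => e := rfl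
  change Finsupp.weight (fun _ => 1) m = d
  rw [← Finsupp.degree_eq_weight_one]
  omega

theorem isHomogeneous_one_of_X_mul {j : Fin n} {l : MvPolynomial (Fin n) κ}
    (h : (X j * l).IsHomogeneous 2) : l.IsHomogeneous 1 := by
  intro m hm
  have := @h (Finsupp.single j 1 + m) (by rwa [coeff_X_mul])
  change Finsupp.weight (fun _ => 1) _ = _ at this
  change Finsupp.weight (fun _ => 1) _ = _
  rw [← Finsupp.degree_eq_weight_one] at this ⊢
  simp at this ⊢
  omega

theorem exists_eq_sum_of_isHomogeneous_one {l : MvPolynomial (Fin n) κ} (h : l.IsHomogeneous 1) :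
    ∃ c : Fin n → κ, l = ∑ j, C (c j) * X j := by
  have := (mem_homogeneousSubmodule 1 l).mpr h
  rw [homogeneousSubmodule_one_eq_span_X, Submodule.mem_span_range_iff_exists_fun] at this
  obtain ⟨c, hc⟩ := this
  exact ⟨c, by simp only [← hc, smul_eq_C_mul]⟩

theorem eq_of_mem_chartRing {t : Fin n → F} (ht : AlgebraicIndependent κ t) {j : Fin n}
    {g : MvPolynomial (Fin n) κ} (hg : g.IsHomogeneous 3)
    (h : aeval t g / t j ^ 2 ∈ chartRing κ t j.succ) : g = 0 := by
  by_contra h0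
  have := totalDegree_le_of_mem_chartRing ht h
  rw [hg.totalDegree h0] at this
  omega

/-- A vector field on projective space. -/
structure ChartGood (t : Fin n → F) (D : Derivation κ F F) : Prop where
  preserves : ∀ j, ∀ x ∈ chartRing κ t j, D x ∈ chartRing κ t j
  scalar : ∃ a, ScalarAt (aeval t : MvPolynomial (Fin n) κ →ₐ[κ] F).toRingHom
    (idealOfVars (Fin n) κ) D a

/-- A linear form evaluated at the affine coordinates. -/
def linForm (t : Fin n → F) (l : Fin (n + 1) → κ) : F :=
  ∑ j, algebraMap κ F (l j) * homCoord t j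

theorem ChartGood.exists_linForm {t : Fin n → F} (ht : AlgebraicIndependent κ t)
    {D : Derivation κ F F} (hD : ChartGood t D) :
    ∃ l : Fin (n + 1) → κ, ∀ i, D (t i) = t i * linForm t l := by
  obtain ⟨a, ha1, ha2⟩ := hD.scalar
  have ht0 : ∀ i, t i ≠ 0 := fun i => ht.ne_zero i
  have hX (i : Fin n) : X i ∈ idealOfVars (Fin n) κ := Ideal.subset_span ⟨i, rfl⟩
  choose q hq2 hq using fun i : Fin n => ha2 (X i) (hX i)
  simp only [AlgHom.toRingHom_eq_coe, RingHom.coe_coe, aeval_X] at hq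
  have hq' (i) : D (t i) = aeval t (C a * X i + q i) := by
    simp only [map_add, map_mul, aeval_X, ← hq, aeval_C]; ring
  have hqh (j : Fin n) : (q j).IsHomogeneous 2 := by
    have h1 : (C a * X j + q j).totalDegree ≤ 2 := by
      apply totalDegree_le_of_mem_chartRing ht (j := j)
      have := hD.preserves j.succ (homCoord t 0 / homCoord t j.succ)
        (Algebra.subset_adjoin ⟨0, rfl⟩)
      simp only [homCoord, Fin.cons_zero, Fin.cons_succ, Derivation.leibniz_div,
        hq'] at this
      convert neg_mem this using 1
      simp
      field_simp
      ring
    refine isHomogeneous_of_mem_pow (hq2 j) ?_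
    have h2 : q j = (C a * X j + q j) - C a * X j := by ring
    rw [h2]
    refine (totalDegree_sub _ _).trans (max_le h1 ?_)
    exact (isHomogeneous_C_mul_X a j).totalDegree_le.trans (by norm_num)
  have hqq (i j : Fin n) : X j * q i = X i * q j := by
    rw [← sub_eq_zero]
    apply eq_of_mem_chartRing ht (j := j)
    · exact ((isHomogeneous_X κ j).mul (hqh i)).sub ((isHomogeneous_X κ i).mul (hqh j))
    · have := hD.preserves j.succ (homCoord t i.succ / homCoord t j.succ)
        (Algebra.subset_adjoin ⟨i.succ, rfl⟩)
      simp only [homCoord, Fin.cons_succ, Derivation.leibniz_div, hq'] at this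
      convert this using 1
      simp
      have := ht0 j
      field_simp
      ring
  have hdvd (j : Fin n) : X j ∣ q j := by
    by_cases h : ∃ i, i ≠ j
    · obtain ⟨i, hi⟩ := h
      have : X j ∣ X i * q j := ⟨q i, (hqq i j).symm⟩
      refine ((X_prime (R := κ) (i := j)).dvd_or_dvd this).resolve_left ?_
      rw [X_dvd_X]
      exact fun h => hi h.symm
    · push Not at h
      have h1 := Ideal.pow_le_self two_ne_zero (hq2 j)
      rw [← Ideal.mem_span_singleton]
      refine Ideal.span_mono ?_ h1
      rintro _ ⟨i, rfl⟩
      rw [h i]; rfl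
  choose l hl using hdvd
  rcases n with _ | n
  · exact ⟨0, fun i => i.elim0⟩
  obtain ⟨c, hc⟩ := exists_eq_sum_of_isHomogeneous_one
    (isHomogeneous_one_of_X_mul (hl 0 ▸ hqh 0))
  have hll (i) : l i = l 0 := by
    have := hqq i 0
    rw [hl i, hl 0] at this
    have h2 : (X 0 * X i : MvPolynomial (Fin (n + 1)) κ) ≠ 0 := mul_ne_zero (X_ne_zero _) (X_ne_zero _)
    apply mul_left_cancel₀ h2
    linear_combination this
  refine ⟨Fin.cons a c, fun i => ?_⟩
  rw [hq', hl i, hll i, hc, linForm]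
  rw [Fin.sum_univ_succ (fun j => algebraMap κ F (Fin.cons (α := fun _ => κ) a c j) * _)]
  simp [homCoord]
  ring

end PolynomialVectorFields

section PolynomialVectorFields2

open MvPolynomial

variable {κ F : Type*} [Field κ] [Field F] [Algebra κ F] {n : ℕ}

/-- `F` is the field of rational functions in `t_1, …, t_n`. -/
structure IsCoordSystem (κ : Type*) [Field κ] [Algebra κ F] (t : Fin n → F) : Prop where
  algInd : AlgebraicIndependent κ t
  frac : ∀ x : F, ∃ f g : MvPolynomial (Fin n) κ, aeval t g ≠ 0 ∧ x = aeval t f / aeval t g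

theorem IsCoordSystem.exists_derivation {t : Fin n → F} (ht : IsCoordSystem κ t) (v : Fin n → F) :
    ∃ D : Derivation κ F F, ∀ i, D (t i) = v i := by
  let : Algebra (MvPolynomial (Fin n) κ) F := (aeval t : MvPolynomial (Fin n) κ →ₐ[κ] F).toAlgebra
  have : IsScalarTower κ (MvPolynomial (Fin n) κ) F := .of_algebraMap_eq' (by
    ext x; simp [RingHom.algebraMap_toAlgebra])
  have : FaithfulSMul (MvPolynomial (Fin n) κ) F :=
    (faithfulSMul_iff_algebraMap_injective _ _).mpr ht.algInd
  have : IsFractionRing (MvPolynomial (Fin n) κ) F := IsFractionRing.of_field _ _ fun z => by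
    obtain ⟨f, g, -, h⟩ := ht.frac z
    exact ⟨f, g, h⟩
  have : Algebra.FormallyEtale (MvPolynomial (Fin n) κ) F :=
    .of_isLocalization (nonZeroDivisors (MvPolynomial (Fin n) κ))
  let d : Derivation κ (MvPolynomial (Fin n) κ) F := mkDerivation κ v
  have hb := KaehlerDifferential.isBaseChange_of_formallyEtale κ (MvPolynomial (Fin n) κ) F
  refine ⟨(hb.lift d.liftKaehlerDifferential).compDer (KaehlerDifferential.D κ F), fun i => ?_⟩
  have h1 : KaehlerDifferential.D κ F (t i) =
      KaehlerDifferential.map κ κ (MvPolynomial (Fin n) κ) F (KaehlerDifferential.D κ _ (X i)) := by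
    rw [KaehlerDifferential.map_D]
    congr 1
    exact (aeval_X t i).symm
  change hb.lift d.liftKaehlerDifferential (KaehlerDifferential.D κ F (t i)) = v i
  rw [h1, hb.lift_eq, Derivation.liftKaehlerDifferential_comp_D, mkDerivation_X]

theorem derivation_aeval_eq_zero {t : Fin n → F} {D : Derivation κ F F} (h : ∀ i, D (t i) = 0)
    (f : MvPolynomial (Fin n) κ) : D (aeval t f) = 0 := by
  induction f using MvPolynomial.induction_on with
  | C a => simp
  | add p q hp hq => simp [hp, hq]
  | mul_X p i hp => simp [hp, h]

theorem IsCoordSystem.derivation_eq_zero {t : Fin n → F} (ht : IsCoordSystem κ t)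
    {D : Derivation κ F F} (h : ∀ i, D (t i) = 0) : D = 0 := by
  ext x
  obtain ⟨f, g, -, rfl⟩ := ht.frac x
  simp [Derivation.leibniz_div, derivation_aeval_eq_zero h]

theorem IsCoordSystem.derivation_ext {t : Fin n → F} (ht : IsCoordSystem κ t)
    {D D' : Derivation κ F F} (h : ∀ i, D (t i) = D' (t i)) : D = D' := by
  rw [← sub_eq_zero]
  exact ht.derivation_eq_zero fun i => by simp [h]

theorem homCoord_mem_chartRing_zero (t : Fin n → F) (j : Fin (n + 1)) :
    homCoord t j ∈ chartRing κ t 0 := by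
  have : homCoord t j / homCoord t 0 ∈ chartRing κ t 0 := Algebra.subset_adjoin ⟨j, rfl⟩
  simpa [homCoord] using this

theorem linForm_div_mem_chartRing (t : Fin n → F) (l : Fin (n + 1) → κ) (j : Fin (n + 1)) :
    linForm t l / homCoord t j ∈ chartRing κ t j := by
  rw [linForm, Finset.sum_div]
  refine sum_mem fun i _ => ?_
  rw [mul_div_assoc, ← Algebra.smul_def]
  have : homCoord t i / homCoord t j ∈ chartRing κ t j := Algebra.subset_adjoin ⟨i, rfl⟩
  exact Subalgebra.smul_mem _ this _

theorem derivation_mem_of_generators {s : Set F} {D : Derivation κ F F} 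
    (h : ∀ x ∈ s, D x ∈ Algebra.adjoin κ s) {x : F} (hx : x ∈ Algebra.adjoin κ s) :
    D x ∈ Algebra.adjoin κ s := by
  induction hx using Algebra.adjoin_induction with
  | mem x hx => exact h x hx
  | algebraMap r => simp
  | add x y _ _ hx hy => rw [map_add]; exact add_mem hx hy
  | mul x y h1 h2 hx hy =>
    rw [D.leibniz, smul_eq_mul, smul_eq_mul]; exact add_mem (mul_mem h1 hy) (mul_mem h2 hx)

theorem linForm_eq_aeval (t : Fin n → F) (l : Fin (n + 1) → κ) :
    linForm t l = aeval t (C (l 0) + ∑ i : Fin n, C (l i.succ) * X i) := by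
  simp [linForm, homCoord, Fin.sum_univ_succ]

theorem ChartGood.of_linForm {t : Fin n → F} (ht : ∀ i, t i ≠ 0)
    {D : Derivation κ F F} {l : Fin (n + 1) → κ} (hD : ∀ i, D (t i) = t i * linForm t l) :
    ChartGood t D := by
  have hpoly (f : MvPolynomial (Fin n) κ) : ∃ g ∈ idealOfVars (Fin n) κ, D (aeval t f) = aeval t g := by
    induction f using MvPolynomial.induction_on with
    | C a => exact ⟨0, zero_mem _, by simp⟩
    | add p q hp hq =>
      obtain ⟨g, hg, hp⟩ := hp
      obtain ⟨g', hg', hq⟩ := hq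
      exact ⟨g + g', add_mem hg hg', by simp [hp, hq]⟩
    | mul_X p i hp =>
      obtain ⟨g, hg, hp⟩ := hp
      refine ⟨p * X i * (C (l 0) + ∑ i : Fin n, C (l i.succ) * X i) + X i * g, 
        add_mem (Ideal.mul_mem_right _ _ (Ideal.mul_mem_left _ _ (Ideal.subset_span ⟨i, rfl⟩)))
          (Ideal.mul_mem_left _ _ hg), ?_⟩
      rw [map_mul, D.leibniz, map_add, map_mul, map_mul, map_mul, aeval_X, hp, hD, linForm_eq_aeval]
      simp; ring
  refine ⟨fun j x hx => derivation_mem_of_generators ?_ hx, l 0, hpoly, fun f hf => ?_⟩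
  · rintro _ ⟨i, rfl⟩
    have hs (i : Fin n) : homCoord t i.succ ≠ 0 := by simpa [homCoord] using ht i
    have hDs (i : Fin n) : D (homCoord t i.succ) = homCoord t i.succ * linForm t l := by
      simpa [homCoord] using hD i
    have hs0 : homCoord t 0 = 1 := rfl
    change _ ∈ chartRing κ t j
    refine Fin.cases ?_ (fun i => ?_) i <;> refine Fin.cases ?_ (fun j => ?_) j
    · simp [hs0]
    · have := neg_mem (linForm_div_mem_chartRing t l j.succ)
      convert this using 1
      simp only [Derivation.leibniz_div, hDs, hs0]
      have := hs j
      simp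
      field_simp
    · simp only [hs0, div_one, hDs]
      exact mul_mem (homCoord_mem_chartRing_zero _ _) (by 
        simpa [hs0] using linForm_div_mem_chartRing t l 0)
    · have : D (homCoord t i.succ / homCoord t j.succ) = 0 := by
        simp only [Derivation.leibniz_div, hDs]
        simp
        right; ring
      rw [this]
      exact zero_mem _
  · change ∃ g ∈ idealOfVars (Fin n) κ ^ 2, D (aeval t f) - algebraMap κ F (l 0) * aeval t f = aeval t g
    induction hf using Submodule.span_induction with
    | mem x hx =>
      obtain ⟨i, rfl⟩ := hx
      refine ⟨X i * ∑ i : Fin n, C (l i.succ) * X i, ?_, ?_⟩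
      · rw [pow_two]
        exact Ideal.mul_mem_mul (Ideal.subset_span ⟨i, rfl⟩) (sum_mem fun i _ => 
          Ideal.mul_mem_left _ _ (Ideal.subset_span ⟨i, rfl⟩))
      · simp [hD, linForm_eq_aeval]; ring
    | zero => exact ⟨0, zero_mem _, by simp⟩
    | add x y _ _ hx hy =>
      obtain ⟨g, hg, hp⟩ := hx
      obtain ⟨g', hg', hq⟩ := hy
      exact ⟨g + g', add_mem hg hg', by rw [map_add (aeval t) g g', ← hp, ← hq]; simp; ring⟩
    | smul a x hx h =>
      obtain ⟨g, hg, hp⟩ := h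
      obtain ⟨g', hg', hq⟩ := hpoly a
      refine ⟨a * g + x * g', add_mem (Ideal.mul_mem_left _ _ hg) ?_, ?_⟩
      · rw [pow_two]
        exact Ideal.mul_mem_mul hx hg'
      · rw [smul_eq_mul, map_mul, D.leibniz, hq, map_add, map_mul, map_mul, ← hp]
        simp; ring

end PolynomialVectorFields2

section Descent

open MvPolynomial

variable {k κ K F : Type*} [Field k] [Field κ] [Field K] [Field F] [Algebra k κ] [Algebra k K]
  [Algebra κ F] [Algebra K F] [Algebra k F] [IsScalarTower k κ F] [IsScalarTower k K F]

/-- The `K`-linear extension `κ ⊗ K → K` of a `k`-linear functional on `κ`. -/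
def coeffMap (h : Algebra.IsPushout k κ K F) (lam : κ →ₗ[k] k) : F →ₗ[K] K :=
  h.symm.out.lift (Algebra.linearMap k K ∘ₗ lam)

theorem coeffMap_algebraMap (h : Algebra.IsPushout k κ K F) (lam : κ →ₗ[k] k) (c : κ) :
    coeffMap h lam (algebraMap κ F c) = algebraMap k K (lam c) :=
  h.symm.out.lift_eq _ c

theorem coeffMap_mul (h : Algebra.IsPushout k κ K F) (lam : κ →ₗ[k] k) (c : κ) (a : K) :
    coeffMap h lam (algebraMap κ F c * algebraMap K F a) = algebraMap k K (lam c) * a := by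
  rw [mul_comm, ← Algebra.smul_def, map_smul, coeffMap_algebraMap, smul_eq_mul, mul_comm]

theorem coeffMap_smul (h : Algebra.IsPushout k κ K F) (lam : κ →ₗ[k] k) (x : F) (a : K) :
    coeffMap h lam (algebraMap K F a * x) = a * coeffMap h lam x := by
  rw [← Algebra.smul_def, map_smul, smul_eq_mul]

theorem mem_span_coeffMap (h : Algebra.IsPushout k κ K F) (x : F) :
    x ∈ Submodule.span κ (Set.range fun lam => algebraMap K F (coeffMap h lam x)) := by
  let b := Module.Basis.ofVectorSpace k κ
  obtain ⟨s, hs⟩ : ∃ s : Finset (Module.Basis.ofVectorSpaceIndex k κ), ∀ s', s ⊆ s' →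
      x = ∑ i ∈ s', algebraMap κ F (b i) * algebraMap K F (coeffMap h (b.coord i) x) := by
    classical
    refine h.symm.out.inductionOn x _ ⟨∅, by simp⟩ (fun c => ?_) (fun a x hx => ?_)
      (fun x y hx hy => ?_)
    · refine ⟨(b.repr c).support, fun s' hs' => ?_⟩
      have h1 : c = ∑ i ∈ s', b.repr c i • b i := by
        conv_lhs => rw [← b.linearCombination_repr c, Finsupp.linearCombination_apply]
        exact Finsupp.sum_of_support_subset _ hs' _ (by simp)
      have h2 (i) : algebraMap κ F (b i) * algebraMap K F (coeffMap h (b.coord i)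
          (algebraMap κ F c)) = algebraMap κ F (b.repr c i • b i) := by
        rw [coeffMap_algebraMap, ← IsScalarTower.algebraMap_apply, Algebra.smul_def, map_mul,
          ← IsScalarTower.algebraMap_apply, mul_comm]
        rfl
      change algebraMap κ F c = ∑ i ∈ s', algebraMap κ F (b i) *
        algebraMap K F (coeffMap h (b.coord i) (algebraMap κ F c))
      simp only [h2]
      rw [← map_sum, ← h1]
    · obtain ⟨s, hs⟩ := hx
      refine ⟨s, fun s' hs' => ?_⟩
      conv_lhs => rw [hs s' hs']
      rw [Finset.smul_sum]
      refine Finset.sum_congr rfl fun i _ => ?_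
      rw [map_smul, Algebra.smul_def, smul_eq_mul, map_mul]
      ring
    · obtain ⟨s, hs⟩ := hx
      obtain ⟨s₂, hs₂⟩ := hy
      refine ⟨s ∪ s₂, fun s' hs' => ?_⟩
      conv_lhs => rw [hs s' (Finset.union_subset_left hs'), hs₂ s' (Finset.union_subset_right hs')]
      rw [← Finset.sum_add_distrib]
      refine Finset.sum_congr rfl fun i _ => ?_
      rw [map_add, map_add, mul_add]
  rw [hs s subset_rfl]
  refine sum_mem fun i _ => ?_
  rw [← Algebra.smul_def]
  refine Submodule.smul_mem _ _ (Submodule.subset_span ⟨b.coord i, ?_⟩)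
  rw [← hs s subset_rfl]

theorem exists_derivation_of_pushout (h : Algebra.IsPushout k κ K F) (d : K →ₗ[k] K)
    (hd : ∀ x y, d (x * y) = x * d y + y * d x) :
    ∃ D : Derivation κ F F, ∀ x : K, D (algebraMap K F x) = algebraMap K F (d x) := by
  let f : F →ₗ[κ] F := h.out.lift ((IsScalarTower.toAlgHom k K F).toLinearMap ∘ₗ d)
  have hf (x : K) : f (algebraMap K F x) = algebraMap K F (d x) := h.out.lift_eq _ x
  refine ⟨Derivation.mk' f fun x y => ?_, hf⟩
  refine h.out.inductionOn x _ (by simp) (fun x => ?_) (fun a x hx => ?_) (fun x x' hx hx' => ?_)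
  · refine h.out.inductionOn y _ (by simp) (fun y => ?_) (fun a y hy => ?_) (fun y y' hy hy' => ?_)
    · change f (algebraMap K F x * algebraMap K F y) = algebraMap K F x • f (algebraMap K F y) +
        algebraMap K F y • f (algebraMap K F x)
      rw [← map_mul, hf, hf, hf, hd]
      simp
    · simp only [mul_smul_comm, map_smul, hy, smul_add, smul_eq_mul, smul_mul_assoc] at *
    · simp only [mul_add, map_add, hy, hy', smul_eq_mul, add_mul]; ring
  · simp only [mul_smul_comm, map_smul, hx, smul_add, smul_eq_mul, smul_mul_assoc] at *
  · simp only [add_mul, map_add, hx, hx', smul_eq_mul, mul_add]; ring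

theorem exists_derivation_coeffMap (h : Algebra.IsPushout k κ K F) (D : Derivation κ F F)
    (lam : κ →ₗ[k] k) : ∃ D' : Derivation κ F F,
      ∀ x : K, D' (algebraMap K F x) = algebraMap K F (coeffMap h lam (D (algebraMap K F x))) := by
  let d : K →ₗ[k] K := (coeffMap h lam).restrictScalars k ∘ₗ D.toLinearMap.restrictScalars k ∘ₗ
    (IsScalarTower.toAlgHom k K F).toLinearMap
  refine exists_derivation_of_pushout h d fun x y => ?_
  change coeffMap h lam (D (algebraMap K F (x * y))) = x * coeffMap h lam (D (algebraMap K F y)) +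
    y * coeffMap h lam (D (algebraMap K F x))
  rw [map_mul, D.leibniz, map_add, smul_eq_mul, smul_eq_mul, coeffMap_smul, coeffMap_smul]

variable {n : ℕ}

/-- `linForm` as a linear map. -/
def linFormMap (t : Fin n → F) : (Fin (n + 1) → κ) →ₗ[κ] F where
  toFun := linForm t
  map_add' x y := by simp [linForm, add_mul, Finset.sum_add_distrib]
  map_smul' a x := by simp [linForm, Finset.mul_sum, mul_assoc, Algebra.smul_def]

theorem linForm_eq_zero {t : Fin n → F} (ht : AlgebraicIndependent κ t) {l : Fin (n + 1) → κ}
    (h : linForm t l = 0) : l = 0 := by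
  rw [linForm_eq_aeval] at h
  have := ht (h.trans (map_zero _).symm)
  have h0 (i : Fin n) : l i.succ = 0 := by
    have := congrArg (coeff (Finsupp.single i 1)) this
    have h0 : ¬ (0 = Finsupp.single i 1) := fun h => by simpa using DFunLike.congr_fun h i
    simpa [coeff_sum, coeff_C_mul, coeff_X, coeff_C, h0, Finsupp.single_left_inj] using this
  have h1 : l 0 = 0 := by simpa [h0] using this
  ext i
  exact Fin.cases h1 h0 i

theorem IsCoordSystem.eq_smul {t : Fin n → F} (ht : IsCoordSystem κ t) {D E : Derivation κ F F}
    {l : Fin (n + 1) → κ} (hE : ∀ i, E (t i) = t i) (hD : ∀ i, D (t i) = t i * linForm t l) (x : F) :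
    D x = linForm t l * E x := by
  have : D = linForm t l • E := ht.derivation_ext fun i => by simp [hE, hD, mul_comm]
  rw [this]; rfl

theorem exists_rational_forms (h : Algebra.IsPushout k κ K F) {t : Fin n → F}
    (ht : IsCoordSystem κ t) (Good : Derivation κ F F → Prop)
    (h1 : ∀ D, Good D → ∃ l : Fin (n + 1) → κ, ∀ i, D (t i) = t i * linForm t l)
    (h2 : ∀ (D : Derivation κ F F) (l : Fin (n + 1) → κ), (∀ i, D (t i) = t i * linForm t l) →
      Good D)
    (h3 : ∀ (D D' : Derivation κ F F) (lam : κ →ₗ[k] k), Good D → (∀ x : K,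
      D' (algebraMap K F x) = algebraMap K F (coeffMap h lam (D (algebraMap K F x)))) → Good D') :
    ∃ v : Fin (n + 1) → Fin (n + 1) → κ, LinearIndependent κ v ∧
      ∀ i j, ∃ x : K, algebraMap K F x * linForm t (v j) = linForm t (v i) := by
  rcases n with _ | n
  · have : Subsingleton (Fin (0 + 1)) := inferInstanceAs (Subsingleton (Fin 1))
    refine ⟨1, LinearIndependent.of_subsingleton 0 (by simp), fun i j => ⟨1, ?_⟩⟩
    rw [Subsingleton.elim i j]; simp
  obtain ⟨E, hE⟩ := ht.exists_derivation t
  obtain ⟨a, ha⟩ : ∃ a : K, E (algebraMap K F a) ≠ 0 := by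
    by_contra! hcon
    have : ∀ x, E x = 0 := fun x => by
      refine h.out.inductionOn x _ (by simp) hcon (fun a x hx => by simp [hx])
        (fun x y hx hy => by simp [hx, hy])
    exact ht.algInd.ne_zero 0 ((hE 0).symm.trans (this _))
  let T : (Fin (n + 2) → κ) →ₗ[κ] F :=
    LinearMap.mulRight κ (E (algebraMap K F a)) ∘ₗ linFormMap t
  have hT (l) : T l = linForm t l * E (algebraMap K F a) := rfl
  have hTinj : Function.Injective T := by
    rw [injective_iff_map_eq_zero]
    intro l hl
    rw [hT, mul_eq_zero, or_iff_left ha] at hl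
    exact linForm_eq_zero ht.algInd hl
  let L : Set (Fin (n + 2) → κ) := {l | ∃ x : K, algebraMap K F x = T l}
  have hL : Submodule.span κ L = ⊤ := by
    rw [eq_top_iff]
    intro l _
    obtain ⟨D, hD⟩ := ht.exists_derivation fun i => t i * linForm t l
    have key : T l ∈ (Submodule.span κ L).map T := by
      rw [Submodule.map_span]
      refine Submodule.span_mono ?_ (mem_span_coeffMap h (T l))
      rintro _ ⟨lam, rfl⟩
      obtain ⟨D', hD'⟩ := exists_derivation_coeffMap h D lam
      obtain ⟨l', hl'⟩ := h1 _ (h3 D D' lam (h2 D l hD) hD')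
      have e : T l' = algebraMap K F (coeffMap h lam (T l)) := by
        rw [hT, hT, ← ht.eq_smul hE hl', ← ht.eq_smul hE hD, hD']
      exact ⟨l', ⟨_, e.symm⟩, e⟩
    obtain ⟨l', hl', e⟩ := key
    rwa [← hTinj e]
  obtain ⟨b, hbL, hb, hbi⟩ := exists_linearIndependent κ L
  let B : Module.Basis b κ (Fin (n + 2) → κ) := .mk hbi (by rw [Subtype.range_coe, hb, hL])
  let e : b ≃ Fin (n + 2) := B.indexEquiv (Pi.basisFun κ (Fin (n + 2)))
  refine ⟨fun i => B (e.symm i), B.linearIndependent.comp _ e.symm.injective, fun i j => ?_⟩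
  have hB (i) : B i ∈ L := by
    rw [Module.Basis.mk_apply]; exact hbL i.2
  obtain ⟨x, hx⟩ := hB (e.symm i)
  obtain ⟨y, hy⟩ := hB (e.symm j)
  have hne : T (B (e.symm j)) ≠ 0 := by
    rw [Ne, map_eq_zero_iff _ hTinj]; exact B.ne_zero _
  refine ⟨x / y, ?_⟩
  rw [map_div₀, hx, hy, hT, hT]
  rw [hT] at hne
  have := left_ne_zero_of_mul hne
  field_simp

end Descent

section Localization

variable {κ F : Type*} [Field κ] [Field F] [Algebra κ F] {R O : Type*} [CommRing R] [CommRing O]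
  [Algebra R O] {D : Derivation κ F F}

theorem Preserves.of_isLocalization (M : Submonoid R) [IsLocalization M O] {φ : O →+* F}
    (h : Preserves (φ.comp (algebraMap R O)) D) : Preserves φ D := by
  intro x
  obtain ⟨r, s, rfl⟩ := IsLocalization.exists_mk'_eq M x
  obtain ⟨g, hg⟩ := h r
  obtain ⟨g', hg'⟩ := h s
  simp only [RingHom.comp_apply] at hg hg'
  have hs : φ (algebraMap R O s) ≠ 0 := ((IsLocalization.map_units O s).map φ).ne_zero
  have hmk (r : R) (s : M) : φ (IsLocalization.mk' O r s) * φ (algebraMap R O s) =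
      φ (algebraMap R O r) := by
    rw [← map_mul, IsLocalization.mk'_spec]
  have e : φ (IsLocalization.mk' O r s) = φ (algebraMap R O r) / φ (algebraMap R O s) := by
    rw [eq_div_iff hs, hmk]
  refine ⟨IsLocalization.mk' O (s * g - r * g') (s * s), ?_⟩
  have e2 := hmk (s * g - r * g') (s * s)
  have hs2 : φ (algebraMap R O (s * s : M)) = φ (algebraMap R O s) ^ 2 := by
    simp [pow_two]
  rw [hs2, ← eq_div_iff (pow_ne_zero 2 hs)] at e2
  rw [e2, e, Derivation.leibniz_div, hg, hg']
  simp only [map_sub, map_mul, smul_eq_mul]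
  field_simp

theorem ScalarAt.of_isLocalization (M : Submonoid R) [IsLocalization M O] {φ : O →+* F} {I : Ideal R}
    {a : κ} (h : ScalarAt (φ.comp (algebraMap R O)) I D a) :
    ScalarAt φ (I.map (algebraMap R O)) D a := by
  have hs (s : M) : φ (algebraMap R O s) ≠ 0 := ((IsLocalization.map_units O s).map φ).ne_zero
  have hmk (r : R) (s : M) : φ (IsLocalization.mk' O r s) * φ (algebraMap R O s) =
      φ (algebraMap R O r) := by
    rw [← map_mul, IsLocalization.mk'_spec]
  have e (r : R) (s : M) : φ (IsLocalization.mk' O r s) = φ (algebraMap R O r) / φ (algebraMap R O s) := by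
    rw [eq_div_iff (hs s), hmk]
  have hs2 (s : M) : φ (algebraMap R O (s * s : M)) = φ (algebraMap R O s) ^ 2 := by
    simp [pow_two]
  constructor
  · intro x
    obtain ⟨r, s, rfl⟩ := IsLocalization.exists_mk'_eq M x
    obtain ⟨g, hgI, hg⟩ := h.1 r
    obtain ⟨g', hgI', hg'⟩ := h.1 s
    simp only [RingHom.comp_apply] at hg hg'
    refine ⟨IsLocalization.mk' O (s * g - r * g') (s * s), ?_, ?_⟩
    · rw [IsLocalization.mk'_mem_map_algebraMap_iff M]
      exact ⟨1, one_mem _, by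
        rw [one_mul]; exact sub_mem (Ideal.mul_mem_left _ _ hgI) (Ideal.mul_mem_left _ _ hgI')⟩
    · have := hs s
      rw [e, e, hs2, Derivation.leibniz_div, hg, hg']
      simp only [map_sub, map_mul, smul_eq_mul]
      field_simp
  · intro x hx
    obtain ⟨⟨⟨r, hr⟩, s⟩, hrs⟩ := (IsLocalization.mem_map_algebraMap_iff M O).mp hx
    obtain ⟨g, hgI, hg⟩ := h.2 r hr
    obtain ⟨g', hgI', hg'⟩ := h.1 s
    simp only [RingHom.comp_apply] at hg hg'
    have hx' : φ x = φ (algebraMap R O r) / φ (algebraMap R O s) := by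
      rw [eq_div_iff (hs s), ← map_mul, hrs]
    refine ⟨IsLocalization.mk' O (s * g - r * g') (s * s), ?_, ?_⟩
    · rw [← Ideal.map_pow, IsLocalization.mk'_mem_map_algebraMap_iff M]
      refine ⟨1, one_mem _, ?_⟩
      rw [one_mul]
      refine sub_mem (Ideal.mul_mem_left _ _ hgI) ?_
      rw [pow_two]
      exact Ideal.mul_mem_mul hr hgI'
    · have := hs s
      rw [sub_eq_iff_eq_add] at hg
      rw [e, hs2, hx', Derivation.leibniz_div, hg, hg']
      simp only [map_sub, map_mul, smul_eq_mul]
      field_simp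
      ring

theorem ScalarAt.of_stalk {φ : O →+* F} (hφ : Function.Injective φ) {m : Ideal R} [hm : m.IsMaximal]
    [IsLocalization.AtPrime O m] [IsLocalRing O] {a : κ} {a' : R}
    (ha : φ (algebraMap R O a') = algebraMap κ F a) (h1 : Preserves (φ.comp (algebraMap R O)) D)
    (h2 : ScalarAt φ (IsLocalRing.maximalIdeal O) D a) :
    ScalarAt (φ.comp (algebraMap R O)) m D a := by
  constructor
  · intro f
    obtain ⟨b, hb⟩ := h1 f
    obtain ⟨g, hgI, hg⟩ := h2.1 (algebraMap R O f)
    refine ⟨b, ?_, hb⟩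
    have : algebraMap R O b = g := hφ (hb.symm.trans hg)
    rw [← this] at hgI
    exact (IsLocalization.AtPrime.to_map_mem_maximal_iff O m b).mp hgI
  · intro f hf
    obtain ⟨b, hb⟩ := h1 f
    obtain ⟨g, hgI, hg⟩ := h2.2 (algebraMap R O f)
      ((IsLocalization.AtPrime.to_map_mem_maximal_iff O m f).mpr hf)
    refine ⟨b - a' * f, ?_, by simp only [map_sub, hb, map_mul]; rw [← ha]; rfl⟩
    have : algebraMap R O (b - a' * f) = g := hφ (by
      rw [← hg, ← ha, map_sub, map_sub, map_mul, map_mul]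
      congr 1
      exact hb.symm)
    rw [← this, ← IsLocalization.AtPrime.map_eq_maximalIdeal m O, ← Ideal.map_pow,
      IsLocalization.algebraMap_mem_map_algebraMap_iff m.primeCompl] at hgI
    obtain ⟨s, hs, hsb⟩ := hgI
    obtain ⟨u, hu⟩ : ∃ u, s * u - 1 ∈ m := by
      obtain ⟨u, v, hv, e⟩ := hm.exists_inv hs
      exact ⟨u, by rw [show s * u - 1 = - v by linear_combination e]; exact neg_mem hv⟩
    have h3 : (s * u - 1) ^ 2 * (b - a' * f) ∈ m ^ 2 :=
      Ideal.mul_mem_right _ _ (Ideal.pow_mem_pow hu 2)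
    have h4 : b - a' * f = (s * u - 1) ^ 2 * (b - a' * f) -
      (s * (b - a' * f)) * (s * u ^ 2 - 2 * u) := by ring
    rw [h4]
    exact sub_mem h3 (Ideal.mul_mem_right _ _ hsb)

theorem Preserves.of_forall_isMaximal {φ : R →+* F}
    (h : ∀ m : Ideal R, m.IsMaximal → ∀ f, ∃ s ∉ m, ∃ b, φ s * D (φ f) = φ b) :
    Preserves φ D := by
  intro f
  let J : Ideal R :=
    { carrier := {r | ∃ b, φ r * D (φ f) = φ b}
      add_mem' := by
        rintro r r' ⟨b, hb⟩ ⟨b', hb'⟩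
        exact ⟨b + b', by rw [map_add, add_mul, hb, hb', map_add]⟩
      zero_mem' := ⟨0, by simp⟩
      smul_mem' := by
        rintro c r ⟨b, hb⟩
        exact ⟨c * b, by rw [smul_eq_mul, map_mul, mul_assoc, hb, map_mul]⟩ }
  by_cases hJ : J = ⊤
  · obtain ⟨b, hb⟩ : (1 : R) ∈ J := hJ ▸ Submodule.mem_top
    exact ⟨b, by simpa using hb⟩
  · obtain ⟨m, hm, hJm⟩ := J.exists_le_maximal hJ
    obtain ⟨s, hs, hb⟩ := h m hm f
    exact (hs (hJm hb)).elim

end Localization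

section BaseChange

variable {k κ K F : Type*} [Field k] [Field κ] [Field K] [Field F] [Algebra k κ] [Algebra k K]
  [Algebra κ F] [Algebra K F] [Algebra k F] [IsScalarTower k κ F] [IsScalarTower k K F]

/-- A pair of subrings `A ⊆ K` and `B = κ A ⊆ F`. -/
structure CompatRings (k κ K F : Type*) [Field k] [Field κ] [Field K] [Field F] [Algebra k K]
    [Algebra κ F] [Algebra K F] {A B : Type*} [CommRing A] [CommRing B] (iA : k →+* A)
    (iB : κ →+* B) (ι : A →+* B) (φA : A →+* K) (φB : B →+* F) : Prop where
  scalarA : ∀ c, φA (iA c) = algebraMap k K c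
  scalarB : ∀ c, φB (iB c) = algebraMap κ F c
  comm : ∀ a, φB (ι a) = algebraMap K F (φA a)
  span : ∀ b, b ∈ AddSubmonoid.closure (Set.range fun p : κ × A => iB p.1 * ι p.2)

variable {A B : Type*} [CommRing A] [CommRing B] {iA : k →+* A} {iB : κ →+* B} {ι : A →+* B}
  {φA : A →+* K} {φB : B →+* F}

omit [Algebra k κ] [Algebra k F] [IsScalarTower k κ F] [IsScalarTower k K F] in
theorem CompatRings.mem_closure_of_mem_map (H : CompatRings k κ K F iA iB ι φA φB) {J : Ideal A}
    {b : B} (hb : b ∈ J.map ι) :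
    b ∈ AddSubmonoid.closure ((fun p : κ × A => iB p.1 * ι p.2) '' {p | p.2 ∈ J}) := by
  induction hb using Submodule.span_induction with
  | mem x hx =>
    obtain ⟨a, ha, rfl⟩ := hx
    exact AddSubmonoid.subset_closure ⟨(1, a), ha, by simp⟩
  | zero => exact zero_mem _
  | add x y _ _ hx hy => exact add_mem hx hy
  | smul c x hx0 hx =>
    clear hx0
    rw [smul_eq_mul]
    clear * - H hx
    induction H.span c using AddSubmonoid.closure_induction with
    | zero => simp
    | add c c' _ _ hc hc' => rw [add_mul]; exact add_mem hc hc'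
    | mem c hc =>
      obtain ⟨⟨c, a⟩, rfl⟩ := hc
      induction hx using AddSubmonoid.closure_induction with
      | zero => simp
      | add c c' _ _ hc hc' => rw [mul_add]; exact add_mem hc hc'
      | mem x hx =>
        obtain ⟨⟨c', a'⟩, ha', rfl⟩ := hx
        exact AddSubmonoid.subset_closure ⟨(c * c', a * a'), J.mul_mem_left _ ha', by
          simp only [map_mul]; ring⟩

theorem CompatRings.exists_coeffMap (H : CompatRings k κ K F iA iB ι φA φB)
    (h : Algebra.IsPushout k κ K F) (lam : κ →ₗ[k] k) {J : Ideal A} {b : B} (hb : b ∈ J.map ι) :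
    ∃ a ∈ J, coeffMap h lam (φB b) = φA a := by
  have key := H.mem_closure_of_mem_map hb
  clear hb
  induction key using AddSubmonoid.closure_induction with
  | zero => exact ⟨0, zero_mem _, by simp⟩
  | add c c' _ _ hc hc' =>
    obtain ⟨a, ha, e⟩ := hc
    obtain ⟨a', ha', e'⟩ := hc'
    exact ⟨a + a', add_mem ha ha', by simp [e, e']⟩
  | mem x hx =>
    obtain ⟨⟨c, a⟩, ha, rfl⟩ := hx
    refine ⟨iA (lam c) * a, J.mul_mem_left _ ha, ?_⟩
    simp only [map_mul, H.scalarA, H.scalarB, H.comm, coeffMap_mul]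

theorem CompatRings.preserves (H : CompatRings k κ K F iA iB ι φA φB)
    (h : Algebra.IsPushout k κ K F) (lam : κ →ₗ[k] k) {D D' : Derivation κ F F}
    (hD' : ∀ x : K, D' (algebraMap K F x) = algebraMap K F (coeffMap h lam (D (algebraMap K F x))))
    (hD : Preserves φB D) : Preserves φB D' := by
  intro b
  induction H.span b using AddSubmonoid.closure_induction with
  | zero => exact ⟨0, by simp⟩
  | add c c' _ _ hc hc' =>
    obtain ⟨a, e⟩ := hc
    obtain ⟨a', e'⟩ := hc'
    exact ⟨a + a', by simp [e, e']⟩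
  | mem x hx =>
    obtain ⟨⟨c, a⟩, rfl⟩ := hx
    obtain ⟨b, hb⟩ := hD (ι a)
    obtain ⟨a', -, ha'⟩ := H.exists_coeffMap h lam (J := ⊤) (b := b) (by simp [Ideal.map_top])
    refine ⟨iB c * ι a', ?_⟩
    rw [H.comm] at hb
    simp [map_mul, H.scalarB, H.comm, hD', hb, ha']

theorem CompatRings.scalarAt (H : CompatRings k κ K F iA iB ι φA φB)
    (h : Algebra.IsPushout k κ K F) (lam : κ →ₗ[k] k) {D D' : Derivation κ F F}
    (hD' : ∀ x : K, D' (algebraMap K F x) = algebraMap K F (coeffMap h lam (D (algebraMap K F x))))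
    {I : Ideal A} {α : κ} (hD : ScalarAt φB (I.map ι) D α) :
    ScalarAt φB (I.map ι) D' (algebraMap k κ (lam α)) := by
  constructor
  · intro b
    induction H.span b using AddSubmonoid.closure_induction with
    | zero => exact ⟨0, zero_mem _, by simp⟩
    | add c c' _ _ hc hc' =>
      obtain ⟨a, ha, e⟩ := hc
      obtain ⟨a', ha', e'⟩ := hc'
      exact ⟨a + a', add_mem ha ha', by simp [e, e']⟩
    | mem x hx =>
      obtain ⟨⟨c, a⟩, rfl⟩ := hx
      obtain ⟨b, hbI, hb⟩ := hD.1 (ι a)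
      obtain ⟨a', haI', ha'⟩ := H.exists_coeffMap h lam hbI
      refine ⟨iB c * ι a', Ideal.mul_mem_left _ _ (Ideal.mem_map_of_mem _ haI'), ?_⟩
      rw [H.comm] at hb
      simp [map_mul, H.scalarB, H.comm, hD', hb, ha']
  · intro f hf
    have key := H.mem_closure_of_mem_map hf
    clear hf
    induction key using AddSubmonoid.closure_induction with
    | zero => exact ⟨0, zero_mem _, by simp⟩
    | add c c' hm hm' hc hc' =>
      obtain ⟨a, ha, e⟩ := hc
      obtain ⟨a', ha', e'⟩ := hc'
      refine ⟨a + a', add_mem ha ha', ?_⟩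
      rw [map_add φB a a', ← e, ← e', map_add, map_add]; ring
    | mem x hx =>
      obtain ⟨⟨c, a⟩, haI, rfl⟩ := hx
      obtain ⟨b, hbI, hb⟩ := hD.2 (ι a) (Ideal.mem_map_of_mem _ haI)
      rw [← Ideal.map_pow] at hbI
      obtain ⟨a', haI', ha'⟩ := H.exists_coeffMap h lam hbI
      refine ⟨iB c * ι a', Ideal.mul_mem_left _ _ (by
        rw [← Ideal.map_pow]; exact (Ideal.mem_map_of_mem _ haI')), ?_⟩
      rw [H.comm, sub_eq_iff_eq_add] at hb
      simp only [map_mul, H.scalarB, H.comm, Derivation.leibniz, hD', hb, map_add, ha',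
        coeffMap_mul, Derivation.map_algebraMap, smul_eq_mul]
      rw [← IsScalarTower.algebraMap_apply k K F, ← IsScalarTower.algebraMap_apply k κ F]
      ring

omit [Algebra k F] [IsScalarTower k κ F] [IsScalarTower k K F] in
theorem CompatRings.ker_eq_map (H : CompatRings k κ K F iA iB ι φA φB) (pA : A →+* k) (pB : B →+* κ)
    (hA : ∀ c, pA (iA c) = c) (hB : ∀ c, pB (iB c) = c)
    (hAB : ∀ a, pB (ι a) = algebraMap k κ (pA a)) (hι : ∀ c, ι (iA c) = iB (algebraMap k κ c)) :
    RingHom.ker pB = (RingHom.ker pA).map ι := by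
  apply le_antisymm
  · intro b hb
    have key : b - iB (pB b) ∈ (RingHom.ker pA).map ι := by
      clear hb
      induction H.span b using AddSubmonoid.closure_induction with
      | zero => simp
      | add c c' _ _ hc hc' =>
        rw [map_add, map_add, add_sub_add_comm]; exact add_mem hc hc'
      | mem x hx =>
        obtain ⟨⟨c, a⟩, rfl⟩ := hx
        have : iB c * ι a - iB (pB (iB c * ι a)) = iB c * ι (a - iA (pA a)) := by
          simp only [map_mul, hB, hAB, map_sub, hι]; ring
        simp only [this]
        refine Ideal.mul_mem_left _ _ (Ideal.mem_map_of_mem _ ?_)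
        simp [RingHom.mem_ker, hA]
    rw [RingHom.mem_ker] at hb
    simpa [hb] using key
  · rw [Ideal.map_le_iff_le_comap]
    intro a ha
    rw [RingHom.mem_ker] at ha
    simp [hAB, ha]

end BaseChange

section Away
open HomogeneousLocalization MvPolynomial

variable (R : Type u) [CommRing R] (n : ℕ)

/-- The standard grading of `R[x_0, …, x_n]`. -/
abbrev stdGrading := MvPolynomial.homogeneousSubmodule (Fin (n + 1)) R

lemma X_mem (j : Fin (n + 1)) : (X j : MvPolynomial (Fin (n + 1)) R) ∈ stdGrading R n 1 :=
  isHomogeneous_X _ _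

/-- The constants inside a degree zero localization of `R[x_0, …, x_n]`. -/
def awayConst (f : MvPolynomial (Fin (n + 1)) R) : R →+* Away (stdGrading R n) f :=
  (fromZeroRingHom (stdGrading R n) _).comp (algebraMap R (stdGrading R n 0))

@[simp] lemma val_awayConst (f : MvPolynomial (Fin (n + 1)) R) (r : R) :
    (awayConst R n f r).val = algebraMap _ _ (C r : MvPolynomial (Fin (n + 1)) R) := by
  rfl

variable {n}

/-- The fraction `x_i / f`, for `f` a linear form. -/
def affineCoord (f : MvPolynomial (Fin (n + 1)) R) (hf : f ∈ stdGrading R n 1)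
    (i : Fin (n + 1)) : Away (stdGrading R n) f :=
  Away.mk (stdGrading R n) hf 1 (X i) (by simpa using X_mem R n i)

/-- The coordinate ring of the affine chart `x_j ≠ 0` as a polynomial ring. -/
def chartHom (j : Fin (n + 1)) :
    MvPolynomial (Fin n) R →+* Away (stdGrading R n) (X j : MvPolynomial (Fin (n + 1)) R) :=
  eval₂Hom (awayConst R n _) fun i => affineCoord R (X j) (X_mem R n j) (j.succAbove i)

/-- Dehomogenisation at the `j`-th coordinate. -/
def dehom (j : Fin (n + 1)) : MvPolynomial (Fin (n + 1)) R →+* MvPolynomial (Fin n) R :=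
  eval₂Hom C (j.insertNth 1 X)

lemma val_chartHom_dehom (j : Fin (n + 1)) (a : MvPolynomial (Fin (n + 1)) R) {m : ℕ}
    (ha : a ∈ stdGrading R n m) :
    algebraMap _ _ (X j : MvPolynomial (Fin (n + 1)) R) ^ m * (chartHom R j (dehom R j a)).val =
      algebraMap _ _ a := by
  have key : ∀ i : Fin (n + 1), algebraMap _ (Localization.Away (X j : MvPolynomial (Fin (n + 1)) R))
      (X j : MvPolynomial (Fin (n + 1)) R) *
      (chartHom R j (dehom R j (X i))).val =
        algebraMap _ (Localization.Away (X j : MvPolynomial (Fin (n + 1)) R))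
          (X i : MvPolynomial (Fin (n + 1)) R) := by
    intro i
    refine Fin.succAboveCases j ?_ (fun i => ?_) i
    · simp [dehom, chartHom]
    · simp only [dehom, chartHom, coe_eval₂Hom, eval₂_X, Fin.insertNth_apply_succAbove,
        affineCoord, Away.val_mk, Localization.mk_eq_mk']
      simp
  rw [a.as_sum]
  simp only [map_sum]
  have hs : (∀ (s : Finset (Fin (n+1) →₀ ℕ)) (g : (Fin (n+1) →₀ ℕ) → Away (stdGrading R n)
      (X j : MvPolynomial (Fin (n + 1)) R)), (∑ d ∈ s, g d).val = ∑ d ∈ s, (g d).val) := by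
    intro s g
    exact map_sum (algebraMap (Away (stdGrading R n) (X j : MvPolynomial (Fin (n + 1)) R)) _) g s
  rw [hs, Finset.mul_sum]
  refine Finset.sum_congr rfl fun d hd => ?_
  have hdm : ∑ i, d i = m := by
    have := ha (mem_support_iff.mp hd)
    simpa [Finsupp.weight_apply, Finsupp.sum_fintype] using this
  rw [monomial_eq, Finsupp.prod_fintype _ _ (by simp)]
  simp only [map_mul, map_prod, map_pow]
  have hp : (∀ (g : Fin (n+1) → Away (stdGrading R n)
      (X j : MvPolynomial (Fin (n + 1)) R)), (∏ i, g i).val = ∏ i, (g i).val) := by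
    intro g
    exact map_prod (algebraMap (Away (stdGrading R n) (X j : MvPolynomial (Fin (n + 1)) R)) _) g _
  rw [val_mul, hp, ← hdm, ← Finset.prod_pow_eq_pow_sum, mul_left_comm, ← Finset.prod_mul_distrib]
  simp only [val_pow, ← mul_pow, key]
  simp [dehom, chartHom]

lemma chartHom_surjective (j : Fin (n + 1)) : Function.Surjective (chartHom R j) := by
  intro x
  obtain ⟨m, a, ha, rfl⟩ := Away.mk_surjective _ (X_mem R n j) x
  refine ⟨dehom R j a, ?_⟩
  apply val_injective
  rw [Away.val_mk, Localization.mk_eq_mk', IsLocalization.eq_mk'_iff_mul_eq]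
  rw [mul_comm, map_pow, val_chartHom_dehom]
  simpa using ha

lemma chartHom_injective (j : Fin (n + 1)) : Function.Injective (chartHom R j) := by
  let ρ : Localization.Away (X j : MvPolynomial (Fin (n + 1)) R) →+* MvPolynomial (Fin n) R :=
    IsLocalization.Away.lift (X j : MvPolynomial (Fin (n + 1)) R) (g := dehom R j)
      (by simp [dehom])
  have hρ : ∀ a, ρ (algebraMap _ _ a) = dehom R j a := fun a => IsLocalization.Away.lift_eq _ _ _
  have : (ρ.comp (algebraMap (Away (stdGrading R n) _) _)).comp (chartHom R j) = RingHom.id _ := by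
    ext i
    · simp [chartHom, hρ, dehom]
    · have h1 : ρ (affineCoord R (X j) (X_mem R n j) (j.succAbove i)).val = X i := by
        rw [affineCoord, Away.val_mk, Localization.mk_eq_mk']
        have := congrArg ρ (IsLocalization.mk'_spec (Localization.Away
          (X j : MvPolynomial (Fin (n + 1)) R)) (X (j.succAbove i))
          (⟨(X j : MvPolynomial (Fin (n + 1)) R) ^ 1, ⟨1, rfl⟩⟩ : Submonoid.powers (X j : MvPolynomial (Fin (n + 1)) R)))
        rw [map_mul, hρ, hρ] at this
        simpa [dehom] using this
      simp [chartHom, h1]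
  intro a b hab
  have h := congrArg (ρ.comp (algebraMap (Away (stdGrading R n) _) _)) hab
  rw [← RingHom.comp_apply, ← RingHom.comp_apply, this] at h
  exact h

/-- The coordinate ring of the affine chart `x_j ≠ 0` is a polynomial ring. -/
def chartEquiv (j : Fin (n + 1)) :
    MvPolynomial (Fin n) R ≃+* Away (stdGrading R n) (X j : MvPolynomial (Fin (n + 1)) R) :=
  RingEquiv.ofBijective (chartHom R j) ⟨chartHom_injective R j, chartHom_surjective R j⟩

end Away

section ProjMap
open HomogeneousLocalization MvPolynomial

variable (R : Type u) [CommRing R] {n : ℕ}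

/-- The structure morphism of `Proj R[x_0, …, x_n]`. -/
def projToSpec (R : Type u) [CommRing R] (n : ℕ) :
    Proj (stdGrading R n) ⟶ Spec (CommRingCat.of R) :=
  Proj.toSpecZero _ ≫ Spec.map (CommRingCat.ofHom (algebraMap R (stdGrading R n 0)))

lemma awayι_toSpec (f : MvPolynomial (Fin (n + 1)) R) {m : ℕ} (hf : f ∈ stdGrading R n m)
    (hm : 0 < m) :
    Proj.awayι (stdGrading R n) f hf hm ≫ projToSpec R n =
      Spec.map (CommRingCat.ofHom (awayConst R n f)) := by
  rw [projToSpec, Proj.awayι_toSpecZero_assoc, ← Spec.map_comp]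
  rfl

lemma mem_span_of_irrelevant {L : Fin (n + 1) → MvPolynomial (Fin (n + 1)) R}
    (h : ∀ i, X i ∈ Ideal.span (Set.range L)) :
    (HomogeneousIdeal.irrelevant (stdGrading R n)).toIdeal ≤ Ideal.span (Set.range L) := by
  refine (HomogeneousIdeal.toIdeal_irrelevant_le _).mpr fun i hi x hx => ?_
  have hx' : x ∈ idealOfVars (Fin (n + 1)) R := by
    rw [← pow_one (idealOfVars (Fin (n + 1)) R), mem_pow_idealOfVars_iff']
    intro d hd
    by_contra hne
    have h1 : d.weight 1 = i := hx (by simpa using hne)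
    have h2 : d.weight 1 = d.degree := by
      rw [Finsupp.weight_apply, Finsupp.degree_eq_sum, Finsupp.sum_fintype] <;> simp
    omega
  rw [idealOfVars] at hx'
  refine (Ideal.span_le.mpr ?_) hx'
  rintro _ ⟨i, rfl⟩
  exact h i

variable {R' : Type u} [CommRing R']

variable {R}

/-- The graded ring homomorphism `R[x] → R'[x]` given by linear forms. -/
def linSubst (φ : R →+* R') (L : Fin (n + 1) → MvPolynomial (Fin (n + 1)) R')
    (hL : ∀ i, L i ∈ stdGrading R' n 1) : stdGrading R n →+*ᵍ stdGrading R' n where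
  __ := eval₂Hom (C.comp φ) L
  map_mem {i x} hx := by
    have := (IsHomogeneous.eval₂ (n := 1) (m := i) hx (C.comp φ) L
      (fun r => isHomogeneous_C _ _) hL)
    simpa using this

@[simp] lemma linSubst_X (φ : R →+* R') (L : Fin (n + 1) → MvPolynomial (Fin (n + 1)) R')
    (hL : ∀ i, L i ∈ stdGrading R' n 1) (i : Fin (n + 1)) : linSubst φ L hL (X i) = L i :=
  eval₂_X _ _ _

@[simp] lemma linSubst_C (φ : R →+* R') (L : Fin (n + 1) → MvPolynomial (Fin (n + 1)) R')
    (hL : ∀ i, L i ∈ stdGrading R' n 1) (r : R) : linSubst φ L hL (C r) = C (φ r) :=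
  eval₂_C _ _ _

lemma irrelevant_le_map (f : stdGrading R n →+*ᵍ stdGrading R' n)
    (h : ∀ i, X i ∈ Ideal.span (Set.range fun j => f (X j))) :
    HomogeneousIdeal.irrelevant (stdGrading R' n) ≤
      (HomogeneousIdeal.irrelevant (stdGrading R n)).map f := by
  change (HomogeneousIdeal.irrelevant (stdGrading R' n)).toIdeal ≤
    ((HomogeneousIdeal.irrelevant (stdGrading R n)).map f).toIdeal
  refine ((mem_span_of_irrelevant R' h).trans (Ideal.span_le.mpr ?_))
  rintro _ ⟨j, rfl⟩
  exact Ideal.mem_map_of_mem f (HomogeneousIdeal.mem_irrelevant_of_mem _ one_pos (X_mem R n j))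

lemma awayMap_awayConst (φ : R →+* R') (f : stdGrading R n →+*ᵍ stdGrading R' n)
    (hf : ∀ r, f (C r) = C (φ r)) (s : MvPolynomial (Fin (n + 1)) R) (r : R) :
    Away.map f s (awayConst R n s r) = awayConst R' n (f s) (φ r) := by
  change Away.map f s (HomogeneousLocalization.mk _) = HomogeneousLocalization.mk _
  rw [Away.map, HomogeneousLocalization.map_mk]
  ext
  simp only [HomogeneousLocalization.val_mk]
  simp [algebraMap_eq, hf]

lemma map_toSpec (φ : R →+* R') (f : stdGrading R n →+*ᵍ stdGrading R' n)
    (hf : ∀ r, f (C r) = C (φ r))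
    (h : ∀ i, X i ∈ Ideal.span (Set.range fun j => f (X j))) :
    Proj.map f (irrelevant_le_map f h) ≫ projToSpec R n =
      projToSpec R' n ≫ Spec.map (CommRingCat.ofHom φ) := by
  refine (Proj.affineOpenCoverOfIrrelevantLESpan (stdGrading R' n) (fun j => f (X j))
    (fun j => f.2 (X_mem R n j)) (fun _ => one_pos)
    (mem_span_of_irrelevant R' h)).openCover.hom_ext _ _ fun j => ?_
  have key : ∀ j : Fin (n + 1), Proj.awayι _ _ (f.2 (X_mem R n j)) one_pos ≫
      Proj.map f (irrelevant_le_map f h) ≫ projToSpec R n =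
      Proj.awayι _ _ (f.2 (X_mem R n j)) one_pos ≫
        projToSpec R' n ≫ Spec.map (CommRingCat.ofHom φ) := by
    intro j
    have e1 := Proj.awayι_comp_map_assoc f (irrelevant_le_map f h) one_pos _ (X_mem R n j)
      (projToSpec R n)
    refine e1.trans ?_
    rw [awayι_toSpec, ← Category.assoc,
      awayι_toSpec, ← Spec.map_comp, ← Spec.map_comp, ← CommRingCat.ofHom_comp,
      ← CommRingCat.ofHom_comp]
    congr 2
    exact RingHom.ext fun r => awayMap_awayConst φ f hf _ r
  exact key j

end ProjMap

section Charts
open HomogeneousLocalization MvPolynomial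

variable (R : Type u) [CommRing R] (n : ℕ)

lemma irrelevant_le_span_X : (HomogeneousIdeal.irrelevant (stdGrading R n)).toIdeal ≤
    Ideal.span (Set.range (X : Fin (n + 1) → MvPolynomial (Fin (n + 1)) R)) :=
  mem_span_of_irrelevant R fun _ => Ideal.subset_span ⟨_, rfl⟩

/-- The standard affine open cover of projective space. -/
def stdCover : (Proj (stdGrading R n)).AffineOpenCover :=
  Proj.affineOpenCoverOfIrrelevantLESpan (stdGrading R n) (fun j : Fin (n + 1) => X j)
    (X_mem R n) (fun _ => one_pos) (irrelevant_le_span_X R n)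

variable {n} in
/-- The standard affine chart of projective space. -/
def chartι (j : Fin (n + 1)) :
    Spec (CommRingCat.of (MvPolynomial (Fin n) R)) ⟶ Proj (stdGrading R n) :=
  Spec.map (chartEquiv R j).toCommRingCatIso.inv ≫
    Proj.awayι (stdGrading R n) (X j) (X_mem R n j) one_pos

variable {n} in
instance (j : Fin (n + 1)) : IsOpenImmersion (chartι R j) := by
  unfold chartι; infer_instance

variable {n} in
lemma SpecMap_chartHom_chartι (j : Fin (n + 1)) :
    Spec.map (CommRingCat.ofHom (chartHom R j)) ≫ chartι R j =
      Proj.awayι (stdGrading R n) (X j) (X_mem R n j) one_pos := by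
  rw [chartι, ← Category.assoc, ← Spec.map_comp]
  have : (chartEquiv R j).toCommRingCatIso.inv ≫ CommRingCat.ofHom (chartHom R j) = 𝟙 _ :=
    (chartEquiv R j).toCommRingCatIso.inv_hom_id
  rw [this, Spec.map_id, Category.id_comp]

variable {n} in
lemma chartι_toSpec (j : Fin (n + 1)) :
    chartι R j ≫ projToSpec R n = Spec.map (CommRingCat.ofHom C) := by
  have : Spec.map (CommRingCat.ofHom (chartHom R j)) ≫ chartι R j ≫ projToSpec R n =
      Spec.map (CommRingCat.ofHom (chartHom R j)) ≫ Spec.map (CommRingCat.ofHom C) := by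
    rw [← Category.assoc, SpecMap_chartHom_chartι, awayι_toSpec, ← Spec.map_comp]
    congr 1
    ext r : 2
    exact (eval₂_C _ _ _).symm
  have hi : IsIso (Spec.map (CommRingCat.ofHom (chartHom R j))) := by
    change IsIso (Spec.map (chartEquiv R j).toCommRingCatIso.hom)
    infer_instance
  exact (cancel_epi _).mp this

lemma iSup_basicOpen_X : ⨆ j : Fin (n + 1), Proj.basicOpen (stdGrading R n) (X j) = ⊤ :=
  Proj.iSup_basicOpen_eq_top _ _ (irrelevant_le_span_X R n)

instance [IsDomain R] : IsReduced (Proj (stdGrading R n)) := by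
  have : ∀ i, IsReduced ((stdCover R n).openCover.X i) := by
    intro j
    change IsReduced (Spec (CommRingCat.of
      (Away (stdGrading R n) (X j : MvPolynomial (Fin (n + 1)) R))))
    have : IsDomain (Away (stdGrading R n) (X j : MvPolynomial (Fin (n + 1)) R)) :=
      MulEquiv.isDomain _ (chartEquiv R j).symm.toMulEquiv
    infer_instance
  exact IsReduced.of_openCover _ (stdCover R n).openCover

instance [IsDomain R] : IrreducibleSpace (Proj (stdGrading R n)) := by
  let η : ProjectiveSpectrum (stdGrading R n) :=
    ⟨⊥, (Ideal.isPrime_bot : (⊥ : Ideal (MvPolynomial (Fin (n + 1)) R)).IsPrime), fun h => by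
      have h1 := h (HomogeneousIdeal.mem_irrelevant_of_mem _ one_pos (X_mem R n 0))
      exact X_ne_zero (R := R) (0 : Fin (n + 1)) h1⟩
  have h : closure {η} = (Set.univ : Set (ProjectiveSpectrum (stdGrading R n))) := by
    refine Set.eq_univ_of_forall fun x => ?_
    rw [← ProjectiveSpectrum.le_iff_mem_closure]
    exact (bot_le : (⊥ : HomogeneousIdeal (stdGrading R n)) ≤ x.asHomogeneousIdeal)
  have h2 : IsIrreducible (closure {η}) := isIrreducible_singleton.closure
  rw [h] at h2
  have h3 : IrreducibleSpace (ProjectiveSpectrum (stdGrading R n)) :=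
    (irreducibleSpace_def _).mpr h2
  exact h3

instance [IsDomain R] : IsIntegral (Proj (stdGrading R n)) :=
  isIntegral_of_irreducibleSpace_of_isReduced _

/-- The origin of the standard chart. -/
def origin : Spec (CommRingCat.of R) ⟶ Proj (stdGrading R n) :=
  Spec.map (CommRingCat.ofHom (eval (0 : Fin n → R))) ≫ chartι R 0

lemma origin_toSpec : origin R n ≫ projToSpec R n = 𝟙 _ := by
  rw [origin, Category.assoc, chartι_toSpec, ← Spec.map_comp, ← CommRingCat.ofHom_comp]
  have : (eval (0 : Fin n → R)).comp C = RingHom.id R := by ext; simp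
  rw [this]
  exact Spec.map_id _

end Charts

lemma isPullback_of_openCover {X Y S S' : Scheme.{u}} {f : Y ⟶ X} {sY : Y ⟶ S'} {sX : X ⟶ S}
    {s : S' ⟶ S} (𝒰 : X.OpenCover) {W : 𝒰.I₀ → Scheme.{u}}
    (a : ∀ i, W i ⟶ Y) (b : ∀ i, W i ⟶ 𝒰.X i) (h1 : ∀ i, IsPullback (b i) (a i) (𝒰.f i) f)
    (h2 : ∀ i, IsPullback (b i) (a i ≫ sY) (𝒰.f i ≫ sX) s) : IsPullback f sY sX s := by
  refine Scheme.isPullback_of_openCover _ _ _ _ 𝒰 fun i => ?_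
  refine IsPullback.of_iso (h2 i) ((h1 i).flip.isoPullback) (Iso.refl _) (Iso.refl _)
    (Iso.refl _) ?_ ?_ (by simp) (by simp)
  · exact ((Category.comp_id _).trans (IsPullback.isoPullback_hom_snd _).symm)
  · refine (Category.comp_id _).trans (Eq.symm ?_)
    exact (Category.assoc _ _ _).symm.trans
      (congrArg (· ≫ sY) (IsPullback.isoPullback_hom_fst (h1 i).flip))

section LinMap
open HomogeneousLocalization MvPolynomial

variable {R R' : Type u} [CommRing R'] [CommRing R] {n : ℕ}

/-- The quotient of two linear forms, in a degree zero localization. -/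
def linFrac (s l : MvPolynomial (Fin (n + 1)) R) (hs : s ∈ stdGrading R n 1)
    (hl : l ∈ stdGrading R n 1) : Away (stdGrading R n) s :=
  Away.mk (stdGrading R n) hs 1 l (by simpa using hl)

/-- The morphism between projective spaces given by linear forms. -/
def linMap (φ : R →+* R') (L : Fin (n + 1) → MvPolynomial (Fin (n + 1)) R')
    (hL : ∀ i, L i ∈ stdGrading R' n 1) (h : ∀ i, X i ∈ Ideal.span (Set.range L)) :
    Proj (stdGrading R' n) ⟶ Proj (stdGrading R n) :=
  Proj.map (linSubst φ L hL) (irrelevant_le_map _ (by simpa using h))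

variable (φ : R →+* R') (L : Fin (n + 1) → MvPolynomial (Fin (n + 1)) R')
    (hL : ∀ i, L i ∈ stdGrading R' n 1) (h : ∀ i, X i ∈ Ideal.span (Set.range L))

lemma linMap_toSpec : linMap φ L hL h ≫ projToSpec R n =
    projToSpec R' n ≫ Spec.map (CommRingCat.ofHom φ) :=
  map_toSpec φ _ (fun r => linSubst_C _ _ _ r) (by simpa using h)

/-- The morphism `linMap` on charts. -/
def linMapChart (j : Fin (n + 1)) (s : MvPolynomial (Fin (n + 1)) R')
    (hs : s ∈ stdGrading R' n 1) : MvPolynomial (Fin n) R →+* Away (stdGrading R' n) s :=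
  eval₂Hom ((awayConst R' n s).comp φ) fun i => linFrac s (L (j.succAbove i)) hs (hL _)

lemma awayι_linMap (j : Fin (n + 1)) (s : MvPolynomial (Fin (n + 1)) R')
    (hs : s ∈ stdGrading R' n 1) (hsL : L j = s) :
    Proj.awayι (stdGrading R' n) s hs one_pos ≫ linMap φ L hL h =
      Spec.map (CommRingCat.ofHom (linMapChart φ L hL j s hs)) ≫ chartι R j := by
  have hs' : linSubst φ L hL (X j) = s := (linSubst_X _ _ _ j).trans hsL
  subst hs'
  have e1 := Proj.awayι_comp_map (linSubst φ L hL) (irrelevant_le_map _ (by simpa using h))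
    one_pos (X j) (X_mem R n j)
  refine e1.trans ?_
  rw [← SpecMap_chartHom_chartι, ← Category.assoc, ← Spec.map_comp, ← CommRingCat.ofHom_comp]
  congr 3
  refine MvPolynomial.ringHom_ext (fun r => ?_) fun i => ?_
  · simp only [RingHom.comp_apply, chartHom, linMapChart, coe_eval₂Hom, eval₂_C]
    exact awayMap_awayConst φ _ (fun r => linSubst_C _ _ _ r) _ r
  · simp only [RingHom.comp_apply, chartHom, linMapChart, coe_eval₂Hom, eval₂_X]
    apply HomogeneousLocalization.val_injective
    rw [affineCoord, Away.mk, Away.map, HomogeneousLocalization.map_mk]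
    simp only [HomogeneousLocalization.val_mk, linFrac, Away.val_mk]
    simp

lemma gradedRingHom_ext {f g : stdGrading R n →+*ᵍ stdGrading R' n}
    (hC : ∀ r, f (C r) = g (C r)) (hX : ∀ i, f (X i) = g (X i)) : f = g := by
  have h1 : (f : MvPolynomial (Fin (n + 1)) R →+* MvPolynomial (Fin (n + 1)) R') =
      (g : MvPolynomial (Fin (n + 1)) R →+* MvPolynomial (Fin (n + 1)) R') :=
    MvPolynomial.ringHom_ext hC hX
  exact DFunLike.ext _ _ fun x => congrArg (fun F : MvPolynomial (Fin (n + 1)) R →+*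
    MvPolynomial (Fin (n + 1)) R' => F x) h1

lemma projMap_congr {f g : stdGrading R n →+*ᵍ stdGrading R' n} (e : f = g)
    (hf : HomogeneousIdeal.irrelevant (stdGrading R' n) ≤
      (HomogeneousIdeal.irrelevant (stdGrading R n)).map f)
    (hg : HomogeneousIdeal.irrelevant (stdGrading R' n) ≤
      (HomogeneousIdeal.irrelevant (stdGrading R n)).map g) :
    Proj.map f hf = Proj.map g hg := by
  subst e
  rfl

lemma linMap_comp {R'' : Type u} [CommRing R''] (ψ : R' →+* R'')
    (M : Fin (n + 1) → MvPolynomial (Fin (n + 1)) R'')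
    (hM : ∀ i, M i ∈ stdGrading R'' n 1) (h' : ∀ i, X i ∈ Ideal.span (Set.range M))
    (N : Fin (n + 1) → MvPolynomial (Fin (n + 1)) R'')
    (hN : ∀ i, N i ∈ stdGrading R'' n 1) (h'' : ∀ i, X i ∈ Ideal.span (Set.range N))
    (e : ∀ i, linSubst ψ M hM (L i) = N i) :
    linMap ψ M hM h' ≫ linMap φ L hL h = linMap (ψ.comp φ) N hN h'' := by
  have e1 := Proj.map_comp (hf := irrelevant_le_map (linSubst φ L hL) (by simpa using h))
    (hg := irrelevant_le_map (linSubst ψ M hM) (by simpa using h'))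
  refine e1.symm.trans ?_
  exact projMap_congr (gradedRingHom_ext (fun r => by simp) fun i => by simp [e]) _ _

lemma X_mem_span_X (i : Fin (n + 1)) : (X i : MvPolynomial (Fin (n + 1)) R) ∈
    Ideal.span (Set.range (X : Fin (n + 1) → MvPolynomial (Fin (n + 1)) R)) :=
  Ideal.subset_span ⟨i, rfl⟩

variable (R n) in
lemma linMap_id : linMap (RingHom.id R) X (X_mem R n) X_mem_span_X = 𝟙 _ :=
  (projMap_congr (gradedRingHom_ext (fun r => by simp) fun i => by simp) _ _).trans
    (Proj.map_id (𝒜 := stdGrading R n))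

variable {L} in
include hL in
lemma X_mem_span_of_linSubst (L' : Fin (n + 1) → MvPolynomial (Fin (n + 1)) R)
    (hL' : ∀ i, L' i ∈ stdGrading R n 1) {φ : R →+* R'}
    (e : ∀ i, linSubst φ L hL (L' i) = X i) (i : Fin (n + 1)) :
    X i ∈ Ideal.span (Set.range L) := by
  rw [← e i]
  have h1 := hL' i
  have h2 := irrelevant_le_span_X R n
    (HomogeneousIdeal.mem_irrelevant_of_mem _ one_pos (hL' i))
  have h3 := Ideal.mem_map_of_mem (linSubst φ L hL) h2
  rw [Ideal.map_span] at h3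
  convert h3
  rw [← Set.range_comp]
  congr 1
  funext j
  simp

/-- The base change morphism between projective spaces. -/
def baseMap (φ : R →+* R') (n : ℕ) : Proj (stdGrading R' n) ⟶ Proj (stdGrading R n) :=
  linMap φ X (X_mem R' n) X_mem_span_X

lemma chartι_baseMap (j : Fin (n + 1)) :
    chartι R' j ≫ baseMap φ n = Spec.map (CommRingCat.ofHom (map φ)) ≫ chartι R j := by
  have hi : IsIso (Spec.map (CommRingCat.ofHom (chartHom R' j))) := by
    change IsIso (Spec.map (chartEquiv R' j).toCommRingCatIso.hom)
    infer_instance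
  rw [← cancel_epi (Spec.map (CommRingCat.ofHom (chartHom R' j))), ← Category.assoc,
    SpecMap_chartHom_chartι, ← Category.assoc, ← Spec.map_comp, ← CommRingCat.ofHom_comp]
  refine (awayι_linMap φ X (X_mem R' n) X_mem_span_X j (X j) (X_mem R' n j) rfl).trans ?_
  congr 3
  refine MvPolynomial.ringHom_ext (fun r => ?_) fun i => ?_
  · simp [linMapChart, chartHom]
  · simp [linMapChart, chartHom, linFrac, affineCoord]

lemma opensRange_chartι (j : Fin (n + 1)) :
    (chartι R j).opensRange = Proj.basicOpen (stdGrading R n) (X j) := by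
  unfold chartι
  refine (Scheme.Hom.opensRange_comp_of_isIso _ _).trans ?_
  exact Proj.opensRange_awayι _ _ _ _

lemma exists_mem_range_chartι (x : Proj (stdGrading R n)) :
    ∃ (j : Fin (n + 1)) (y : Spec (CommRingCat.of (MvPolynomial (Fin n) R))),
      chartι R j y = x := by
  have hx : x ∈ ⨆ j : Fin (n + 1), Proj.basicOpen (stdGrading R n) (X j) := by
    rw [iSup_basicOpen_X]
    trivial
  obtain ⟨j, hj⟩ := TopologicalSpace.Opens.mem_iSup.mp hx
  rw [← opensRange_chartι] at hj
  obtain ⟨y, hy⟩ := hj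
  exact ⟨j, y, hy⟩

variable (R n) in
/-- The standard open cover of projective space by affine spaces. -/
def chartCover : (Proj (stdGrading R n)).OpenCover :=
  Scheme.Cover.mkOfCovers (Fin (n + 1)) (fun _ => Spec (CommRingCat.of (MvPolynomial (Fin n) R)))
    (chartι R) exists_mem_range_chartι fun _ => inferInstance

lemma preimage_opensRange_chartι (j : Fin (n + 1)) :
    baseMap φ n ⁻¹ᵁ (chartι R j).opensRange = (chartι R' j).opensRange := by
  rw [opensRange_chartι, opensRange_chartι]
  refine (Proj.map_preimage_basicOpen _ _ (X j)).trans ?_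
  rw [linSubst_X]

lemma isPullback_baseMap : IsPullback (baseMap φ n) (projToSpec R' n)
    (projToSpec R n) (Spec.map (CommRingCat.ofHom φ)) := by
  have h1 (j : Fin (n + 1)) : IsPullback (Spec.map (CommRingCat.ofHom (map φ))) (chartι R' j)
      (chartι R j) (baseMap φ n) :=
    IsOpenImmersion.isPullback _ _ _ _ (chartι_baseMap φ j) (preimage_opensRange_chartι φ j)
  have h2 (j : Fin (n + 1)) : IsPullback (Spec.map (CommRingCat.ofHom (map φ)))
      (chartι R' j ≫ projToSpec R' n) (chartι R j ≫ projToSpec R n)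
      (Spec.map (CommRingCat.ofHom φ)) := by
    let _ : Algebra R R' := φ.toAlgebra
    let _ : Algebra (MvPolynomial (Fin n) R) (MvPolynomial (Fin n) R') :=
      MvPolynomial.algebraMvPolynomial
    have h := isPullback_SpecMap_of_isPushout _ _ _ _
      (CommRingCat.isPushout_of_isPushout R R' (MvPolynomial (Fin n) R) (MvPolynomial (Fin n) R'))
    rw [chartι_toSpec, chartι_toSpec]
    exact h.flip
  exact isPullback_of_openCover (chartCover R n)
    (W := fun _ => Spec (CommRingCat.of (MvPolynomial (Fin n) R'))) (chartι R')
    (fun j => Spec.map (CommRingCat.ofHom (map φ))) h1 h2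

/-- An invertible linear substitution gives an isomorphism. -/
lemma isIso_linMap (L L' : Fin (n + 1) → MvPolynomial (Fin (n + 1)) R)
    (hL : ∀ i, L i ∈ stdGrading R n 1) (hL' : ∀ i, L' i ∈ stdGrading R n 1)
    (h : ∀ i, X i ∈ Ideal.span (Set.range L)) (h' : ∀ i, X i ∈ Ideal.span (Set.range L'))
    (e : ∀ i, linSubst (RingHom.id R) L hL (L' i) = X i)
    (e' : ∀ i, linSubst (RingHom.id R) L' hL' (L i) = X i) :
    IsIso (linMap (RingHom.id R) L hL h) :=
  ⟨linMap (RingHom.id R) L' hL' h',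
    (linMap_comp _ L' hL' h' _ L hL h X (X_mem R n) X_mem_span_X e).trans (linMap_id R n),
    (linMap_comp _ L hL h _ L' hL' h' X (X_mem R n) X_mem_span_X e').trans (linMap_id R n)⟩

/-- The base change square for a change of coordinates. -/
lemma isPullback_linMap (L L' : Fin (n + 1) → MvPolynomial (Fin (n + 1)) R')
    (hL : ∀ i, L i ∈ stdGrading R' n 1) (hL' : ∀ i, L' i ∈ stdGrading R' n 1)
    (h : ∀ i, X i ∈ Ideal.span (Set.range L))
    (e : ∀ i, linSubst (RingHom.id R') L hL (L' i) = X i)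
    (e' : ∀ i, linSubst (RingHom.id R') L' hL' (L i) = X i) :
    IsPullback (linMap φ L hL h) (projToSpec R' n)
      (projToSpec R n) (Spec.map (CommRingCat.ofHom φ)) := by
  have hi := isIso_linMap L L' hL hL' h (X_mem_span_of_linSubst hL' L hL e') e e'
  have h1 := linMap_comp φ X (X_mem R' n) X_mem_span_X (RingHom.id R') L hL h L hL h
    (fun i => linSubst_X _ _ _ i)
  rw [RingHom.id_comp] at h1
  refine (isPullback_baseMap φ).of_iso (asIso (linMap (RingHom.id R') L hL h)).symm (Iso.refl _)
    (Iso.refl _) (Iso.refl _) ?_ ?_ (by simp) (by simp)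
  · simp only [Iso.symm_hom, Iso.refl_hom, Category.comp_id, asIso_inv, ← h1, baseMap,
      IsIso.inv_hom_id_assoc]
  · simp only [Iso.symm_hom, Iso.refl_hom, Category.comp_id, asIso_inv]
    rw [IsIso.eq_inv_comp, linMap_toSpec]
    have : Spec.map (CommRingCat.ofHom (RingHom.id R')) = 𝟙 _ := Spec.map_id _
    rw [this, Category.comp_id]

end LinMap

section Points
open HomogeneousLocalization MvPolynomial

variable {κ : Type u} [Field κ] {n : ℕ}

lemma exists_eval_of_point (p : Spec (CommRingCat.of κ) ⟶ Proj (stdGrading κ n))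
    (hp : p ≫ projToSpec κ n = 𝟙 _) : ∃ (j : Fin (n + 1)) (a : Fin n → κ),
      p = Spec.map (CommRingCat.ofHom (eval a)) ≫ chartι κ j := by
  obtain ⟨j, y, hy⟩ := exists_mem_range_chartι (p default)
  have hr : Set.range p ⊆ Set.range (chartι κ j) := by
    rintro _ ⟨x, rfl⟩
    rw [Subsingleton.elim x default, ← hy]
    exact ⟨y, rfl⟩
  let g := IsOpenImmersion.lift (chartι κ j) p hr
  have hg : g ≫ chartι κ j = p := IsOpenImmersion.lift_fac _ _ _
  obtain ⟨h, hh⟩ := Spec.map_surjective g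
  have hC : CommRingCat.ofHom C ≫ h = 𝟙 _ := by
    apply Spec.map_injective
    rw [Spec.map_comp, hh, ← chartι_toSpec, ← Category.assoc, hg, hp, Spec.map_id]
  have hC' : ∀ r : κ, h.hom (C r) = r := fun r => congrArg (fun F => F.hom r) hC
  refine ⟨j, fun i => h.hom (X i), ?_⟩
  rw [← hg, ← hh]
  congr 2
  ext1
  refine MvPolynomial.ringHom_ext (fun r => ?_) fun i => ?_
  · simpa using hC' r
  · simp

lemma exists_iso_origin (p : Spec (CommRingCat.of κ) ⟶ Proj (stdGrading κ n))
    (hp : p ≫ projToSpec κ n = 𝟙 _) : ∃ σ : Proj (stdGrading κ n) ≅ Proj (stdGrading κ n),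
      σ.hom ≫ projToSpec κ n = projToSpec κ n ∧ origin κ n ≫ σ.hom = p := by
  obtain ⟨j, a, rfl⟩ := exists_eval_of_point p hp
  let L : Fin (n + 1) → MvPolynomial (Fin (n + 1)) κ :=
    j.insertNth (X 0) fun i => X i.succ + C (a i) * X 0
  let L' : Fin (n + 1) → MvPolynomial (Fin (n + 1)) κ :=
    Fin.cons (X j) fun i => X (j.succAbove i) - C (a i) * X j
  have hL : ∀ i, L i ∈ stdGrading κ n 1 := by
    refine Fin.succAboveCases j ?_ fun i => ?_
    · simpa [L] using X_mem κ n 0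
    · simp only [L, Fin.insertNth_apply_succAbove]
      refine add_mem (X_mem κ n _) ?_
      rw [← smul_eq_C_mul]
      exact Submodule.smul_mem _ _ (X_mem κ n _)
  have hL' : ∀ i, L' i ∈ stdGrading κ n 1 := by
    refine Fin.cases ?_ fun i => ?_
    · exact X_mem κ n j
    · simp only [L', Fin.cons_succ]
      refine sub_mem (X_mem κ n _) ?_
      rw [← smul_eq_C_mul]
      exact Submodule.smul_mem _ _ (X_mem κ n _)
  have e : ∀ i, linSubst (RingHom.id κ) L hL (L' i) = X i := by
    refine Fin.cases ?_ fun i => ?_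
    · simp [L', L]
    · simp [L', L]
  have e' : ∀ i, linSubst (RingHom.id κ) L' hL' (L i) = X i := by
    refine Fin.succAboveCases j ?_ fun i => ?_
    · simp [L', L]
    · simp [L', L]
  have h := X_mem_span_of_linSubst hL L' hL' e
  have hi := isIso_linMap L L' hL hL' h (X_mem_span_of_linSubst hL' L hL e') e e'
  refine ⟨asIso (linMap (RingHom.id κ) L hL h), ?_, ?_⟩
  · rw [asIso_hom, linMap_toSpec]
    have : Spec.map (CommRingCat.ofHom (RingHom.id κ)) = 𝟙 _ := Spec.map_id _
    rw [this, Category.comp_id]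
  · have h1 := awayι_linMap (RingHom.id κ) L hL h j (X 0) (X_mem κ n 0) (by simp [L])
    rw [← SpecMap_chartHom_chartι, Category.assoc] at h1
    have h2 : CommRingCat.ofHom (linMapChart (RingHom.id κ) L hL j (X 0) (X_mem κ n 0)) =
        CommRingCat.ofHom (eval₂Hom C fun i => X i + C (a i)) ≫
          CommRingCat.ofHom (chartHom κ 0) := by
      ext1
      refine MvPolynomial.ringHom_ext (fun r => ?_) fun i => ?_
      · simp [linMapChart, chartHom]
      · simp only [linMapChart, coe_eval₂Hom, eval₂_X, CommRingCat.hom_comp, RingHom.comp_apply,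
          CommRingCat.hom_ofHom, chartHom, eval₂_add, eval₂_C]
        apply HomogeneousLocalization.val_injective
        rw [HomogeneousLocalization.val_add, val_awayConst]
        simp only [linFrac, affineCoord, Away.val_mk, L, Fin.insertNth_apply_succAbove]
        rw [← Localization.mk_one_eq_algebraMap, Localization.add_mk]
        rw [Localization.mk_eq_mk_iff, Localization.r_iff_exists]
        refine ⟨1, ?_⟩
        simp
        ring
    rw [h2, Spec.map_comp, Category.assoc] at h1
    have hi : IsIso (Spec.map (CommRingCat.ofHom (chartHom κ (0 : Fin (n + 1))))) := by
      change IsIso (Spec.map (chartEquiv κ 0).toCommRingCatIso.hom)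
      infer_instance
    have h3 := (cancel_epi _).mp h1
    rw [origin, asIso_hom, Category.assoc, h3, ← Category.assoc, ← Spec.map_comp]
    congr 2
    ext1
    refine MvPolynomial.ringHom_ext (fun r => ?_) fun i => ?_
    · simp
    · simp

end Points

section Coordinates
open HomogeneousLocalization MvPolynomial

variable {R F : Type u} [CommRing R] [Field F] {n : ℕ} (φ : R →+* F) (z : Fin (n + 1) → F)

/-- Evaluation of fractions at a point with given homogeneous coordinates. -/
def coordAway (s : MvPolynomial (Fin (n + 1)) R) (hs : eval₂Hom φ z s ≠ 0) :
    Away (stdGrading R n) s →+* F :=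
  (IsLocalization.Away.lift (S := Localization.Away s) s (g := eval₂Hom φ z)
    (isUnit_iff_ne_zero.mpr hs)).comp (algebraMap (Away (stdGrading R n) s) _)

lemma coordAway_const (s : MvPolynomial (Fin (n + 1)) R) (hs : eval₂Hom φ z s ≠ 0) (r : R) :
    coordAway φ z s hs (awayConst R n s r) = φ r := by
  have h1 : algebraMap (Away (stdGrading R n) s) (Localization.Away s) (awayConst R n s r) =
    algebraMap _ _ (C r : MvPolynomial (Fin (n + 1)) R) := val_awayConst R n s r
  rw [coordAway, RingHom.comp_apply, h1, IsLocalization.Away.lift_eq]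
  simp

lemma coordAway_mk (s : MvPolynomial (Fin (n + 1)) R) (hs : eval₂Hom φ z s ≠ 0) {d : ℕ}
    (hd : s ∈ stdGrading R n d) (m : ℕ) (a : MvPolynomial (Fin (n + 1)) R)
    (ha : a ∈ stdGrading R n (m • d)) :
    coordAway φ z s hs (Away.mk (stdGrading R n) hd m a ha) =
      eval₂Hom φ z a / eval₂Hom φ z s ^ m := by
  rw [eq_div_iff (pow_ne_zero _ hs), coordAway, RingHom.comp_apply]
  change IsLocalization.Away.lift _ _ (Away.mk (stdGrading R n) hd m a ha).val * _ = _
  rw [Away.val_mk, ← map_pow, ← IsLocalization.Away.lift_eq (S := Localization.Away s) s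
    (isUnit_iff_ne_zero.mpr hs) (s ^ m), ← map_mul,
    ← IsLocalization.Away.lift_eq (S := Localization.Away s) s
    (isUnit_iff_ne_zero.mpr hs) a]
  congr 1
  rw [Localization.mk_eq_mk']
  exact IsLocalization.mk'_spec _ _ _

/-- A point with given homogeneous coordinates, on a basic open subset. -/
lemma coordAway_awayι_mul (s g : MvPolynomial (Fin (n + 1)) R) (hs : eval₂Hom φ z s ≠ 0)
    (hsg : eval₂Hom φ z (s * g) ≠ 0) {d e : ℕ} (hd : s ∈ stdGrading R n d) (h0 : 0 < d)
    (he : g ∈ stdGrading R n e) (hde : s * g ∈ stdGrading R n (d + e)) :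
    Spec.map (CommRingCat.ofHom (coordAway φ z s hs)) ≫ Proj.awayι (stdGrading R n) s hd h0 =
      Spec.map (CommRingCat.ofHom (coordAway φ z (s * g) hsg)) ≫
        Proj.awayι (stdGrading R n) (s * g) hde (by omega) := by
  rw [← Proj.SpecMap_awayMap_awayι (stdGrading R n) hd h0 he rfl, ← Category.assoc,
    ← Spec.map_comp, ← CommRingCat.ofHom_comp]
  congr 3
  ext x
  obtain ⟨m, a, ha, rfl⟩ := Away.mk_surjective _ hd x
  have h1 : eval₂Hom φ z g ≠ 0 := fun h => hsg (by rw [map_mul, h, mul_zero])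
  simp only [RingHom.comp_apply]
  rw [coordAway_mk, awayMap_mk, coordAway_mk, map_mul, map_mul, map_pow, mul_pow,
    mul_div_mul_right _ _ (pow_ne_zero _ h1)]

lemma coordAway_awayι_congr (s g : MvPolynomial (Fin (n + 1)) R) (hs : eval₂Hom φ z s ≠ 0)
    (hg : eval₂Hom φ z g ≠ 0) (hs1 : s ∈ stdGrading R n 1) (hg1 : g ∈ stdGrading R n 1) :
    Spec.map (CommRingCat.ofHom (coordAway φ z s hs)) ≫
        Proj.awayι (stdGrading R n) s hs1 one_pos =
      Spec.map (CommRingCat.ofHom (coordAway φ z g hg)) ≫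
        Proj.awayι (stdGrading R n) g hg1 one_pos := by
  have h1 : eval₂Hom φ z (s * g) ≠ 0 := by
    rw [map_mul]
    exact mul_ne_zero hs hg
  have h2 : eval₂Hom φ z (g * s) ≠ 0 := by rwa [mul_comm]
  rw [coordAway_awayι_mul φ z s g hs h1 hs1 one_pos hg1 (SetLike.mul_mem_graded hs1 hg1),
    coordAway_awayι_mul φ z g s hg h2 hg1 one_pos hs1 (SetLike.mul_mem_graded hg1 hs1)]
  have key : ∀ (p q : MvPolynomial (Fin (n + 1)) R) (e : p = q) (hp : eval₂Hom φ z p ≠ 0)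
      (hq : eval₂Hom φ z q ≠ 0) (hp2 : p ∈ stdGrading R n (1 + 1))
      (hq2 : q ∈ stdGrading R n (1 + 1)),
      Spec.map (CommRingCat.ofHom (coordAway φ z p hp)) ≫
        Proj.awayι (stdGrading R n) p hp2 (by omega) =
      Spec.map (CommRingCat.ofHom (coordAway φ z q hq)) ≫
        Proj.awayι (stdGrading R n) q hq2 (by omega) := by
    rintro p _ rfl _ _ _ _
    rfl
  exact key _ _ (mul_comm s g) _ _ _ _

/-- Affine coordinates of a point with given homogeneous coordinates. -/
def coordHom (j : Fin (n + 1)) : MvPolynomial (Fin n) R →+* F :=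
  eval₂Hom φ fun i => z (j.succAbove i) / z j

lemma coordAway_comp_chartHom (j : Fin (n + 1)) (hj : eval₂Hom φ z (X j) ≠ 0) :
    (coordAway φ z (X j) hj).comp (chartHom R j) = coordHom φ z j := by
  refine MvPolynomial.ringHom_ext (fun r => ?_) fun i => ?_
  · rw [RingHom.comp_apply, chartHom, coe_eval₂Hom, eval₂_C, coordAway_const]
    simp [coordHom]
  · rw [RingHom.comp_apply, chartHom, coe_eval₂Hom, eval₂_X, affineCoord, coordAway_mk]
    simp [coordHom]

lemma coordHom_chartι (j : Fin (n + 1)) (hj : eval₂Hom φ z (X j) ≠ 0) :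
    Spec.map (CommRingCat.ofHom (coordHom φ z j)) ≫ chartι R j =
      Spec.map (CommRingCat.ofHom (coordAway φ z (X j) hj)) ≫
        Proj.awayι (stdGrading R n) (X j) (X_mem R n j) one_pos := by
  rw [← SpecMap_chartHom_chartι, ← Category.assoc, ← Spec.map_comp, ← CommRingCat.ofHom_comp,
    coordAway_comp_chartHom]

lemma coordHom_chartι_congr (i j : Fin (n + 1)) (hi : z i ≠ 0) (hj : z j ≠ 0) :
    Spec.map (CommRingCat.ofHom (coordHom φ z i)) ≫ chartι R i =
      Spec.map (CommRingCat.ofHom (coordHom φ z j)) ≫ chartι R j := by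
  have hi' : eval₂Hom φ z (X i) ≠ 0 := by simpa using hi
  have hj' : eval₂Hom φ z (X j) ≠ 0 := by simpa using hj
  rw [coordHom_chartι φ z i hi', coordHom_chartι φ z j hj']
  exact coordAway_awayι_congr _ _ _ _ _ _ _ _

lemma coordHom_chartι_linMap {R' : Type u} [CommRing R'] (ψ : R' →+* R)
    (L : Fin (n + 1) → MvPolynomial (Fin (n + 1)) R) (hL : ∀ i, L i ∈ stdGrading R n 1)
    (h : ∀ i, X i ∈ Ideal.span (Set.range L)) (i j : Fin (n + 1)) (hi : z i ≠ 0)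
    (hj : eval₂Hom φ z (L j) ≠ 0) :
    Spec.map (CommRingCat.ofHom (coordHom φ z i)) ≫ chartι R i ≫ linMap ψ L hL h =
      Spec.map (CommRingCat.ofHom (coordHom (φ.comp ψ) (fun i => eval₂Hom φ z (L i)) j)) ≫
        chartι R' j := by
  have hi' : eval₂Hom φ z (X i) ≠ 0 := by simpa using hi
  rw [← Category.assoc, coordHom_chartι φ z i hi',
    coordAway_awayι_congr φ z (X i) (L j) hi' hj (X_mem R n i) (hL j), Category.assoc,
    awayι_linMap ψ L hL h j (L j) (hL j) rfl, ← Category.assoc, ← Spec.map_comp,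
    ← CommRingCat.ofHom_comp]
  congr 3
  refine MvPolynomial.ringHom_ext (fun r => ?_) fun i => ?_
  · rw [RingHom.comp_apply, linMapChart, coe_eval₂Hom, eval₂_C, RingHom.comp_apply,
      coordAway_const]
    simp [coordHom]
  · rw [RingHom.comp_apply, linMapChart, coe_eval₂Hom, eval₂_X, linFrac, coordAway_mk]
    simp [coordHom]

end Coordinates

section FunctionField

/-- A field-valued point exhibiting `F` as the function field of an integral scheme. -/
structure IsGenericPt {X : Scheme.{u}} {F : Type u} [Field F] (η : Spec (.of F) ⟶ X) : Prop where
  stalk : ∀ x : X, ∃ g : X.presheaf.stalk x →+* F, Function.Injective g ∧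
    Spec.map (CommRingCat.ofHom g) ≫ X.fromSpecStalk x = η
  frac : ∃ x : X, ∃ g : X.presheaf.stalk x →+* F, Function.Surjective g ∧
    Spec.map (CommRingCat.ofHom g) ≫ X.fromSpecStalk x = η

lemma exists_isGenericPt_of_isField {X : Scheme.{u}} (S : CommRingCat.{u}) (hS : IsField S)
    (η : Spec S ⟶ X) (h1 : ∀ x : X, ∃ g : X.presheaf.stalk x ⟶ S, Function.Injective g.hom ∧
      Spec.map g ≫ X.fromSpecStalk x = η)
    (h2 : ∃ x : X, ∃ g : X.presheaf.stalk x ⟶ S, Function.Surjective g.hom ∧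
      Spec.map g ≫ X.fromSpecStalk x = η) :
    ∃ (F : Type u) (_ : Field F) (η : Spec (.of F) ⟶ X), IsGenericPt η := by
  refine ⟨S, hS.toField, η, @IsGenericPt.mk _ _ hS.toField _ (fun x => ?_) ?_⟩
  · obtain ⟨g, hg, e⟩ := h1 x
    exact ⟨g.hom, hg, e⟩
  · obtain ⟨x, g, hg, e⟩ := h2
    exact ⟨x, g.hom, hg, e⟩

lemma exists_isGenericPt (X : Scheme.{u}) [IsIntegral X] :
    ∃ (F : Type u) (_ : Field F) (η : Spec (.of F) ⟶ X), IsGenericPt η := by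
  refine exists_isGenericPt_of_isField X.functionField (Field.toIsField _)
    (X.fromSpecStalk (genericPoint X)) (fun x => ⟨X.presheaf.stalkSpecializes
      ((genericPoint_spec X).specializes trivial), ?_, ?_⟩) ⟨genericPoint X, 𝟙 _,
      fun x => ⟨x, rfl⟩, ?_⟩
  · exact IsFractionRing.injective (X.presheaf.stalk x) X.functionField
  · exact Scheme.SpecMap_stalkSpecializes_fromSpecStalk _
  · rw [Spec.map_id, Category.id_comp]

variable {A : Type u} [CommRing A] {X : Scheme.{u}} (c : Spec (.of A) ⟶ X) [IsOpenImmersion c]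

/-- The comparison of a ring with the stalks of its spectrum. -/
def specToStalk (y : Spec (.of A)) : CommRingCat.of A ⟶ (Spec (.of A)).presheaf.stalk y :=
  (Scheme.ΓSpecIso (.of A)).inv ≫ (Spec (.of A)).presheaf.germ ⊤ y trivial

lemma specToStalk_isLocalization (y : Spec (.of A)) :
    @IsLocalization.AtPrime A _ ((Spec (.of A)).presheaf.stalk y) _
      (specToStalk y).hom.toAlgebra y.asIdeal y.isPrime :=
  StructureSheaf.IsLocalization.to_stalk A y

/-- The comparison of a chart with the stalks at its points. -/
def chartToStalk (y : Spec (.of A)) : A →+* X.presheaf.stalk (c y) :=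
  (specToStalk y ≫ inv (c.stalkMap y)).hom

lemma chartToStalk_comp (y : Spec (.of A)) :
    Spec.map (CommRingCat.ofHom (chartToStalk c y)) ≫ c = X.fromSpecStalk (c y) := by
  have h1 := Scheme.SpecMap_stalkMap_fromSpecStalk c (x := y)
  have h3 : Spec.map (CommRingCat.ofHom (chartToStalk c y)) =
      Spec.map (inv (c.stalkMap y)) ≫ (Spec (.of A)).fromSpecStalk y := by
    rw [Spec.fromSpecStalk_eq, ← Spec.map_comp]; rfl
  rw [h3, Category.assoc, ← h1, ← Category.assoc, ← Spec.map_comp, IsIso.hom_inv_id,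
    Spec.map_id]
  exact Category.id_comp _

lemma chartToStalk_isLocalization (y : Spec (.of A)) :
    @IsLocalization.AtPrime A _ (X.presheaf.stalk (c y)) _
      (chartToStalk c y).toAlgebra y.asIdeal y.isPrime := by
  let _ := (chartToStalk c y).toAlgebra
  let _ := (specToStalk y).hom.toAlgebra
  have _ := y.isPrime
  have h := specToStalk_isLocalization y
  refine IsLocalization.isLocalization_of_algEquiv (S := (Spec (.of A)).presheaf.stalk y) _ ?_
  exact AlgEquiv.ofRingEquiv (f := (asIso (inv (c.stalkMap y))).commRingCatIsoToRingEquiv)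
    fun r => rfl

variable {F : Type u} [Field F] {η : Spec (.of F) ⟶ X} (hη : IsGenericPt η)

/-- The embedding of a stalk in the function field. -/
def stalkFn (x : X) : X.presheaf.stalk x →+* F := (hη.stalk x).choose

lemma stalkFn_injective (x : X) : Function.Injective (stalkFn hη x) :=
  (hη.stalk x).choose_spec.1

lemma stalkFn_comp (x : X) :
    Spec.map (CommRingCat.ofHom (stalkFn hη x)) ≫ X.fromSpecStalk x = η :=
  (hη.stalk x).choose_spec.2

include hη in
lemma exists_chartFn [Nontrivial A] :
    ∃ φ : A →+* F, Spec.map (CommRingCat.ofHom φ) ≫ c = η := by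
  obtain ⟨m⟩ : Nonempty (PrimeSpectrum A) := inferInstance
  let y : Spec (.of A) := m
  refine ⟨(stalkFn hη (c y)).comp (chartToStalk c y), ?_⟩
  rw [CommRingCat.ofHom_comp, Spec.map_comp, Category.assoc, chartToStalk_comp, stalkFn_comp]

lemma specMap_ext {φ ψ : A →+* F} (h : Spec.map (CommRingCat.ofHom φ) ≫ c =
    Spec.map (CommRingCat.ofHom ψ) ≫ c) : φ = ψ := by
  rw [cancel_mono] at h
  exact congrArg CommRingCat.Hom.hom (Spec.map_injective h)

variable {c}
variable {φ : A →+* F} (hφ : Spec.map (CommRingCat.ofHom φ) ≫ c = η)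
include hη hφ

lemma chartFn_eq (y : Spec (.of A)) : φ = (stalkFn hη (c y)).comp (chartToStalk c y) := by
  refine specMap_ext c ?_
  rw [CommRingCat.ofHom_comp, Spec.map_comp, Category.assoc, chartToStalk_comp, stalkFn_comp, hφ]

lemma chartFn_preserves {κ : Type u} [Field κ] [Algebra κ F] {D : Derivation κ F F}
    (h : ∀ x, Preserves (stalkFn hη x) D) : Preserves φ D := by
  refine Preserves.of_forall_isMaximal fun m hm f => ?_
  let y : Spec (.of A) := ⟨m, hm.isPrime⟩
  let _ := (chartToStalk c y).toAlgebra
  have _ := y.isPrime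
  have hl : IsLocalization.AtPrime (X.presheaf.stalk (c y)) y.asIdeal :=
    chartToStalk_isLocalization c y
  obtain ⟨b, hb⟩ := h (c y) (chartToStalk c y f)
  obtain ⟨⟨a, s⟩, e⟩ := IsLocalization.surj y.asIdeal.primeCompl b
  refine ⟨s, s.2, a, ?_⟩
  have e' : b * chartToStalk c y s = chartToStalk c y a := e
  rw [chartFn_eq hη hφ y, RingHom.comp_apply, RingHom.comp_apply, RingHom.comp_apply, hb, ← e',
    map_mul, mul_comm]

lemma stalkFn_preserves {κ : Type u} [Field κ] [Algebra κ F] {D : Derivation κ F F}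
    (h : Preserves φ D) (y : Spec (.of A)) : Preserves (stalkFn hη (c y)) D := by
  let _ := (chartToStalk c y).toAlgebra
  have _ := y.isPrime
  have hl : IsLocalization.AtPrime (X.presheaf.stalk (c y)) y.asIdeal :=
    chartToStalk_isLocalization c y
  refine Preserves.of_isLocalization y.asIdeal.primeCompl (R := A) ?_
  rw [chartFn_eq hη hφ y] at h
  exact h

lemma stalkFn_scalarAt {κ : Type u} [Field κ] [Algebra κ F] {D : Derivation κ F F} {a : κ}
    (y : Spec (.of A)) (h : ScalarAt φ y.asIdeal D a) :
    ScalarAt (stalkFn hη (c y)) (IsLocalRing.maximalIdeal _) D a := by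
  let _ := (chartToStalk c y).toAlgebra
  have _ := y.isPrime
  have hl : IsLocalization.AtPrime (X.presheaf.stalk (c y)) y.asIdeal :=
    chartToStalk_isLocalization c y
  rw [← IsLocalization.AtPrime.map_eq_maximalIdeal y.asIdeal]
  refine ScalarAt.of_isLocalization y.asIdeal.primeCompl (R := A) ?_
  rw [chartFn_eq hη hφ y] at h
  exact h

lemma chartFn_scalarAt {κ : Type u} [Field κ] [Algebra κ F] {D : Derivation κ F F} {a : κ} {a' : A}
    (ha : φ a' = algebraMap κ F a) (y : Spec (.of A)) (hy : y.asIdeal.IsMaximal)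
    (h1 : Preserves φ D)
    (h : ScalarAt (stalkFn hη (c y)) (IsLocalRing.maximalIdeal _) D a) :
    ScalarAt φ y.asIdeal D a := by
  let _ := (chartToStalk c y).toAlgebra
  have _ := y.isPrime
  have hl : IsLocalization.AtPrime (X.presheaf.stalk (c y)) y.asIdeal :=
    chartToStalk_isLocalization c y
  have e : φ = (stalkFn hη (c y)).comp (algebraMap A _) := chartFn_eq hη hφ y
  rw [e] at h1 ha ⊢
  exact ScalarAt.of_stalk (stalkFn_injective hη _) ha h1 h

lemma chartFn_injective [IsIntegral X] : Function.Injective φ := by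
  have hn : Nontrivial A := φ.domain_nontrivial
  obtain ⟨m⟩ : Nonempty (PrimeSpectrum A) := inferInstance
  let y : Spec (.of A) := m
  have _ : Nonempty (Spec (.of A)) := ⟨y⟩
  have hi : IsIntegral (Spec (.of A)) := isIntegral_of_isOpenImmersion c
  have hd : IsDomain A := (affine_isIntegral_iff (.of A)).mp hi
  let _ := (chartToStalk c y).toAlgebra
  have _ := y.isPrime
  have hl : IsLocalization.AtPrime (X.presheaf.stalk (c y)) y.asIdeal :=
    chartToStalk_isLocalization c y
  rw [chartFn_eq hη hφ y]
  exact (stalkFn_injective hη _).comp (IsLocalization.injective (X.presheaf.stalk (c y))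
    y.asIdeal.primeCompl_le_nonZeroDivisors)

lemma chartFn_frac (x : F) : ∃ a s : A, φ s ≠ 0 ∧ x = φ a / φ s := by
  obtain ⟨x0, g, hg, e⟩ := hη.frac
  have hx0 : x0 ∈ Set.range c := by
    have hloc : IsLocalHom g := .of_surjective g hg
    let pt : Spec (.of F) := IsLocalRing.closedPoint F
    have h1 : η pt = x0 := by
      have h2 : Spec.map (CommRingCat.ofHom g) pt = IsLocalRing.closedPoint _ :=
        IsLocalRing.comap_closedPoint g
      rw [← e, Scheme.Hom.comp_apply, h2, Scheme.fromSpecStalk_closedPoint]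
    rw [← h1, ← hφ, Scheme.Hom.comp_apply]
    exact ⟨_, rfl⟩
  obtain ⟨y, rfl⟩ := hx0
  let _ := (chartToStalk c y).toAlgebra
  have _ := y.isPrime
  have hl : IsLocalization.AtPrime (X.presheaf.stalk (c y)) y.asIdeal :=
    chartToStalk_isLocalization c y
  have h3 : φ = g.comp (chartToStalk c y) := by
    refine specMap_ext c ?_
    rw [CommRingCat.ofHom_comp, Spec.map_comp, Category.assoc, chartToStalk_comp, e, hφ]
  obtain ⟨b, rfl⟩ := hg x
  obtain ⟨⟨a, s⟩, e⟩ := IsLocalization.surj y.asIdeal.primeCompl b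
  have e' : b * chartToStalk c y s = chartToStalk c y a := e
  have hs : φ s ≠ 0 := by
    rw [h3]
    exact ((IsLocalization.map_units (X.presheaf.stalk (c y)) s).map g).ne_zero
  refine ⟨a, s, hs, ?_⟩
  rw [eq_div_iff hs, h3, RingHom.comp_apply, RingHom.comp_apply, ← e', map_mul]

end FunctionField

section
variable {X : Scheme.{u}} {F : Type u} [Field F] {η : Spec (.of F) ⟶ X} (hη : IsGenericPt η)
  {κ : Type u} [Field κ] [Algebra κ F]

/-- A derivation is good at `x₀` if it is regular and acts by a scalar on the cotangent space
at `x₀`. -/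
def IsGood (x₀ : X) (D : Derivation κ F F) : Prop :=
  (∀ x, Preserves (stalkFn hη x) D) ∧
    ∃ a, ScalarAt (stalkFn hη x₀) (IsLocalRing.maximalIdeal _) D a
end

section ProjectiveSpace
open MvPolynomial
variable {κ F : Type u} [Field κ] [Field F] [Algebra κ F] {n : ℕ}
  {η : Spec (.of F) ⟶ Proj (stdGrading κ n)} (hη : IsGenericPt η)
  (hs : η ≫ projToSpec κ n = Spec.map (CommRingCat.ofHom (algebraMap κ F)))

include hη hs in
lemma exists_isCoordSystem : ∃ t : Fin n → F, IsCoordSystem κ t ∧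
    Spec.map (CommRingCat.ofHom (aeval t : MvPolynomial (Fin n) κ →ₐ[κ] F).toRingHom) ≫
      chartι κ 0 = η := by
  obtain ⟨φ, hφ⟩ := exists_chartFn (chartι κ (n := n) 0) hη
  have e : φ = (aeval fun i => φ (X i) : MvPolynomial (Fin n) κ →ₐ[κ] F).toRingHom := by
    have h1 : φ.comp C = algebraMap κ F := by
      rw [← hφ, Category.assoc, chartι_toSpec, ← Spec.map_comp] at hs
      exact congrArg CommRingCat.Hom.hom (Spec.map_injective hs)
    refine MvPolynomial.ringHom_ext (fun r => ?_) fun i => ?_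
    · simpa using congr($h1 r)
    · simp
  refine ⟨fun i => φ (X i), ⟨?_, fun x => ?_⟩, e ▸ hφ⟩
  · have := chartFn_injective hη hφ
    rw [e] at this
    exact this
  · obtain ⟨a, s, h1, h2⟩ := chartFn_frac hη hφ x
    rw [e] at h1 h2
    exact ⟨a, s, h1, h2⟩

variable {t : Fin n → F} (ht : IsCoordSystem κ t)
  (hφ : Spec.map (CommRingCat.ofHom (aeval t : MvPolynomial (Fin n) κ →ₐ[κ] F).toRingHom) ≫
      chartι κ 0 = η)

include ht in
lemma homCoord_ne_zero (j : Fin (n + 1)) : homCoord t j ≠ 0 := by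
  refine Fin.cases ?_ (fun i => ?_) j
  · simp [homCoord]
  · simpa [homCoord] using ht.algInd.ne_zero i

lemma coordHom_homCoord_zero : coordHom (algebraMap κ F) (homCoord t) 0 =
    (aeval t : MvPolynomial (Fin n) κ →ₐ[κ] F).toRingHom := by
  refine MvPolynomial.ringHom_ext (fun r => ?_) fun i => ?_
  · simp [coordHom]
  · simp [coordHom, homCoord]

lemma range_coordHom (j : Fin (n + 1)) :
    ((coordHom (algebraMap κ F) (homCoord t) j).range : Set F) = chartRing κ t j := by
  have e : coordHom (algebraMap κ F) (homCoord t) j = (aeval fun i =>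
      homCoord t (j.succAbove i) / homCoord t j : MvPolynomial (Fin n) κ →ₐ[κ] F).toRingHom := rfl
  rw [e]
  change Set.range _ = _
  have h1 := (Algebra.adjoin_range_eq_range_aeval κ
    fun i => homCoord t (j.succAbove i) / homCoord t j).symm
  refine (congrArg (fun S : Subalgebra κ F => (S : Set F)) h1).trans (congrArg _ ?_)
  refine le_antisymm (Algebra.adjoin_mono ?_) (Algebra.adjoin_le ?_)
  · rintro _ ⟨i, rfl⟩
    exact ⟨j.succAbove i, rfl⟩
  · rintro _ ⟨i, rfl⟩
    obtain rfl | ⟨i, rfl⟩ := Fin.eq_self_or_eq_succAbove j i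
    · by_cases h0 : homCoord t i = 0
      · simp [h0]
      · simp [div_self h0]
    · exact Algebra.subset_adjoin ⟨i, rfl⟩

include ht hφ in
lemma coordHom_homCoord_comp (j : Fin (n + 1)) :
    Spec.map (CommRingCat.ofHom (coordHom (algebraMap κ F) (homCoord t) j)) ≫ chartι κ j = η := by
  rw [coordHom_chartι_congr _ _ j 0 (homCoord_ne_zero ht j) (homCoord_ne_zero ht 0),
    coordHom_homCoord_zero, hφ]

lemma preserves_coordHom_iff (j : Fin (n + 1)) (D : Derivation κ F F) :
    Preserves (coordHom (algebraMap κ F) (homCoord t) j) D ↔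
      ∀ x ∈ chartRing κ t j, D x ∈ chartRing κ t j := by
  have h (x : F) : x ∈ chartRing κ t j ↔
      ∃ a, coordHom (algebraMap κ F) (homCoord t) j a = x := by
    have := congr(x ∈ $(range_coordHom (κ := κ) (t := t) j))
    exact (iff_of_eq this).symm
  constructor
  · rintro H x hx
    obtain ⟨a, rfl⟩ := (h x).mp hx
    obtain ⟨b, hb⟩ := H a
    exact (h _).mpr ⟨b, hb.symm⟩
  · intro H a
    obtain ⟨b, hb⟩ := (h _).mp (H _ ((h _).mpr ⟨a, rfl⟩))
    exact ⟨b, hb.symm⟩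

lemma idealOfVars_eq_ker :
    idealOfVars (Fin n) κ = RingHom.ker (eval (0 : Fin n → κ)) := by
  ext f
  rw [RingHom.mem_ker, ← pow_one (idealOfVars (Fin n) κ), mem_pow_idealOfVars_iff']
  have h : eval (0 : Fin n → κ) f = coeff 0 f := by
    rw [eval_zero]; rfl
  rw [h]
  simp [Finsupp.degree_eq_zero_iff]

include ht hφ in
lemma isGood_origin_iff (pt : Spec (.of κ)) (D : Derivation κ F F) :
    IsGood hη (origin κ n pt) D ↔ ChartGood t D := by
  let y : Spec (.of (MvPolynomial (Fin n) κ)) :=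
    Spec.map (CommRingCat.ofHom (eval (0 : Fin n → κ))) pt
  have hy : y.asIdeal = idealOfVars (Fin n) κ := by
    have h : y.asIdeal = pt.asIdeal.comap (eval (0 : Fin n → κ)) := rfl
    have _ := pt.isPrime
    rw [h, Ideal.eq_bot_of_prime (K := κ) pt.asIdeal, ← RingHom.ker_eq_comap_bot,
      idealOfVars_eq_ker]
  have hmax : y.asIdeal.IsMaximal := by
    rw [hy, idealOfVars_eq_ker]
    exact RingHom.ker_isMaximal_of_surjective _ fun c => ⟨C c, by simp⟩
  have hpt : origin κ n pt = chartι κ 0 y := by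
    rw [origin, Scheme.Hom.comp_apply]
  rw [hpt]
  constructor
  · rintro ⟨h1, a, h2⟩
    refine ⟨fun j => (preserves_coordHom_iff j D).mp
      (chartFn_preserves hη (coordHom_homCoord_comp ht hφ j) h1), a, ?_⟩
    rw [← hy]
    exact chartFn_scalarAt hη hφ (a' := C a) (by simp) y hmax (chartFn_preserves hη hφ h1) h2
  · rintro ⟨h1, a, h2⟩
    refine ⟨fun x => ?_, a, stalkFn_scalarAt hη hφ y (hy ▸ h2)⟩
    obtain ⟨j, z, rfl⟩ := exists_mem_range_chartι x
    exact stalkFn_preserves hη (coordHom_homCoord_comp ht hφ j)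
      ((preserves_coordHom_iff j D).mpr (h1 j)) z

end ProjectiveSpace

section FieldExtension

variable {k κ : Type u} [Field k] [Field κ] (φ : k →+* κ)

instance surjective_specMap_field : Surjective (Spec.map (CommRingCat.ofHom φ)) := by
  refine ⟨fun x => ⟨IsLocalRing.closedPoint κ, ?_⟩⟩
  have : Subsingleton (Spec (.of k)) := inferInstanceAs (Subsingleton (PrimeSpectrum k))
  exact Subsingleton.elim _ _

instance flat_to_spec_field {X : Scheme.{u}} (f : X ⟶ Spec (.of k)) : Flat f := by
  have : Subsingleton (Spec (.of k)) := inferInstanceAs (Subsingleton (PrimeSpectrum k))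
  infer_instance

instance dominant_specMap_field :
    IsSchemeTheoreticallyDominant (Spec.map (CommRingCat.ofHom φ)) := by
  have : IsReduced (Spec (.of k)) := inferInstance
  exact .of_isDominant _

variable {φ} {X P : Scheme.{u}} {q : X ⟶ P} {sX : X ⟶ Spec (.of κ)} {sP : P ⟶ Spec (.of k)}
  (hq : IsPullback q sX sP (Spec.map (CommRingCat.ofHom φ)))

include hq

lemma surjective_of_isPullback : Surjective q :=
  MorphismProperty.of_isPullback hq.flip (surjective_specMap_field φ)

lemma flat_of_isPullback : Flat q :=
  MorphismProperty.of_isPullback hq.flip (flat_to_spec_field _)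

lemma quasiCompact_of_isPullback : QuasiCompact q :=
  MorphismProperty.of_isPullback (P := @QuasiCompact) hq.flip inferInstance

lemma dominant_of_isPullback : IsSchemeTheoreticallyDominant q := by
  exact .of_isPullback hq.flip

lemma isIntegral_of_isPullback [IsIntegral X] : IsIntegral P := by
  have _ := surjective_of_isPullback hq
  have _ := quasiCompact_of_isPullback hq
  have _ := dominant_of_isPullback hq
  refine ⟨⟨q (genericPoint X)⟩, fun U hU => ?_⟩
  have hn : Nonempty (q ⁻¹ᵁ U) := by
    obtain ⟨⟨x, hx⟩⟩ := hU
    obtain ⟨y, rfl⟩ := q.surjective x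
    exact ⟨⟨y, hx⟩⟩
  exact (q.app_injective U).isDomain (q.app U).hom

end FieldExtension

section ChartPairs

open TensorProduct

variable {k κ : Type u} [Field k] [Field κ] [Algebra k κ]

/-- An affine chart of a scheme over `k` and its base change to `κ`. -/
structure ChartPair {X P : Scheme.{u}} (q : X ⟶ P) (sX : X ⟶ Spec (.of κ))
    (sP : P ⟶ Spec (.of k)) where
  A : Type u
  B : Type u
  [commRingA : CommRing A]
  [commRingB : CommRing B]
  c : Spec (.of A) ⟶ P
  d : Spec (.of B) ⟶ X
  [openC : IsOpenImmersion c]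
  [openD : IsOpenImmersion d]
  iA : k →+* A
  iB : κ →+* B
  ι : A →+* B
  c_comp : c ≫ sP = Spec.map (CommRingCat.ofHom iA)
  d_comp : d ≫ sX = Spec.map (CommRingCat.ofHom iB)
  comm : d ≫ q = Spec.map (CommRingCat.ofHom ι) ≫ c
  span : ∀ b, b ∈ AddSubmonoid.closure (Set.range fun p : κ × A => iB p.1 * ι p.2)
  ι_iA : ∀ r, ι (iA r) = iB (algebraMap k κ r)
  ι_injective : Function.Injective ι
  eq_zero : ∀ b : Module.Basis.ofVectorSpaceIndex k κ →₀ A,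
    (b.sum fun i a => iB (Module.Basis.ofVectorSpace k κ i) * ι a) = 0 → b = 0

attribute [instance] ChartPair.commRingA ChartPair.commRingB ChartPair.openC ChartPair.openD

variable {X P : Scheme.{u}} {q : X ⟶ P} {sX : X ⟶ Spec (.of κ)} {sP : P ⟶ Spec (.of k)}
  (hq : IsPullback q sX sP (Spec.map (CommRingCat.ofHom (algebraMap k κ))))

include hq

lemma exists_chartPair (x : X) : ∃ (S : ChartPair q sX sP) (y : Spec (.of S.B)), S.d y = x := by
  obtain ⟨R, c, hc, ⟨a, ha⟩⟩ : ∃ (R : CommRingCat.{u}) (c : Spec R ⟶ P),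
      IsOpenImmersion c ∧ q x ∈ Set.range c :=
    ⟨_, P.affineCover.f (P.affineCover.idx (q x)), P.affineCover.map_prop _, P.affineCover.covers (q x)⟩
  obtain ⟨iA, hiA⟩ := Spec.map_surjective (c ≫ sP)
  let _ : Algebra k R := iA.hom.toAlgebra
  let B := κ ⊗[k] R
  let iB : κ →+* B := Algebra.TensorProduct.includeLeftRingHom
  let ι : R →+* B := (Algebra.TensorProduct.includeRight : R →ₐ[k] B).toRingHom
  have h1 : IsPullback (Spec.map (CommRingCat.ofHom iB)) (Spec.map (CommRingCat.ofHom ι))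
      (Spec.map (CommRingCat.ofHom (algebraMap k κ))) (Spec.map iA) :=
    isPullback_SpecMap_of_isPushout _ _ _ _ (CommRingCat.isPushout_tensorProduct k κ R)
  rw [hiA] at h1
  let d : Spec (.of B) ⟶ X := hq.lift (Spec.map (CommRingCat.ofHom ι) ≫ c)
    (Spec.map (CommRingCat.ofHom iB)) (by rw [Category.assoc, h1.w])
  have hd1 : d ≫ q = Spec.map (CommRingCat.ofHom ι) ≫ c := hq.lift_fst _ _ _
  have hd2 : d ≫ sX = Spec.map (CommRingCat.ofHom iB) := hq.lift_snd _ _ _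
  have h2 : IsPullback d (Spec.map (CommRingCat.ofHom ι)) q c := by
    rw [← hd2] at h1
    exact IsPullback.of_right h1 hd1 hq.flip
  have hdo : IsOpenImmersion d := MorphismProperty.of_isPullback h2.flip hc
  obtain ⟨y, hy, -⟩ := Scheme.exists_preimage_of_isPullback h2 x a ha.symm
  refine ⟨@ChartPair.mk k κ _ _ _ X P q sX sP R B _ _ c d hc hdo iA.hom iB ι hiA.symm hd2 hd1
    ?_ ?_ ?_ ?_, y, hy⟩
  · intro b
    induction b using TensorProduct.induction_on with
    | zero => exact zero_mem _
    | tmul r a =>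
      refine AddSubmonoid.subset_closure ⟨(r, a), ?_⟩
      change (r ⊗ₜ[k] (1 : R)) * ((1 : κ) ⊗ₜ[k] a) = r ⊗ₜ[k] a
      simp
    | add x y hx hy => exact add_mem hx hy
  · intro r
    exact (Algebra.TensorProduct.includeRight : R →ₐ[k] B).commutes r
  · exact Algebra.TensorProduct.includeRight_injective (algebraMap k κ).injective
  · intro b hb
    refine TensorProduct.sum_tmul_basis_left_eq_zero (Module.Basis.ofVectorSpace k κ) b ?_
    rw [← hb]
    refine Finsupp.sum_congr fun i _ => ?_
    change _ = (Module.Basis.ofVectorSpace k κ i ⊗ₜ[k] (1 : R)) * ((1 : κ) ⊗ₜ[k] b i)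
    simp

end ChartPairs

section Pushout

open TensorProduct

variable {k κ K F : Type u} [Field k] [Field κ] [Field K] [Field F] [Algebra k κ] [Algebra k K]
  [Algebra κ F] [Algebra K F] [Algebra k F] [IsScalarTower k κ F] [IsScalarTower k K F]
  {A B : Type u} [CommRing A] [CommRing B] {iA : k →+* A}
  {iB : κ →+* B} {ι : A →+* B} {φA : A →+* K} {φB : B →+* F}

theorem CompatRings.isPushout [Algebra.IsAlgebraic k κ] (H : CompatRings k κ K F iA iB ι φA φB)
    {I : Type u} (ℬ : Module.Basis I k κ)
    (hℬ : ∀ b : I →₀ A, (b.sum fun i a => iB (ℬ i) * ι a) = 0 → b = 0)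
    (hB : Function.Injective φB)
    (hK : ∀ x : K, ∃ a s : A, φA s ≠ 0 ∧ x = φA a / φA s)
    (hF : ∀ x : F, ∃ a s : B, φB s ≠ 0 ∧ x = φB a / φB s) : Algebra.IsPushout k κ K F := by
  classical
  let m : κ ⊗[k] K →ₐ[k] F :=
    Algebra.TensorProduct.productMap (IsScalarTower.toAlgHom k κ F) (IsScalarTower.toAlgHom k K F)
  have hm (r : κ) (x : K) : m (r ⊗ₜ x) = algebraMap κ F r * algebraMap K F x := by simp [m]
  have inj : Function.Injective m := by
    rw [injective_iff_map_eq_zero]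
    intro z hz
    obtain ⟨b, rfl⟩ := (TensorProduct.equivFinsuppOfBasisLeft ℬ).symm.surjective z
    suffices b = 0 by simp [this]
    obtain ⟨s, hs, a, ha⟩ : ∃ s : A, φA s ≠ 0 ∧ ∃ a : I → A, ∀ i ∈ b.support,
        φA s * b i = φA (a i) := by
      choose a s hs h using hK
      refine ⟨∏ i ∈ b.support, s (b i), ?_, fun i =>
        a (b i) * ∏ j ∈ b.support.erase i, s (b j), fun i hi => ?_⟩
      · rw [map_prod]
        exact Finset.prod_ne_zero_iff.mpr fun i _ => hs _
      · rw [← Finset.mul_prod_erase _ _ hi, map_mul, map_mul, mul_right_comm]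
        congr 1
        rw [mul_comm, ← eq_div_iff (hs _)]
        exact h _
    let b' : I →₀ A := Finsupp.onFinset b.support (fun i => if i ∈ b.support then a i else 0)
      fun i hi => by by_contra h; simp [h] at hi
    have hb0 : b' = 0 := by
      apply hℬ
      apply hB
      rw [Finsupp.onFinset_sum _ (fun i => by simp), map_sum, map_zero]
      rw [TensorProduct.equivFinsuppOfBasisLeft_symm_apply, Finsupp.sum, map_sum] at hz
      have h2 := congrArg (algebraMap K F (φA s) * ·) hz
      simp only [mul_zero, Finset.mul_sum] at h2
      rw [← h2]
      refine Finset.sum_congr rfl fun i hi => ?_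
      rw [if_pos hi, map_mul, H.scalarB, H.comm, ← ha i hi, hm, map_mul]
      ring
    ext i
    by_contra hi
    have hi' : i ∈ b.support := Finsupp.mem_support_iff.mpr hi
    have h3 : a i = 0 := by
      have h5 : (if i ∈ b.support then a i else 0) = 0 := congr($hb0 i)
      rwa [if_pos hi'] at h5
    have h4 := ha i hi'
    rw [h3, map_zero] at h4
    exact (mul_ne_zero hs hi) h4
  have surj : Function.Surjective m := by
    let R₀ : Subalgebra K F :=
      { m.range with
        algebraMap_mem' := fun x => ⟨1 ⊗ₜ x, by simp [hm]⟩ }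
    have hR₀ (x : F) : x ∈ R₀ ↔ ∃ z, m z = x := Iff.rfl
    have halg (x : F) (hx : x ∈ R₀) : IsAlgebraic K x := by
      obtain ⟨z, rfl⟩ := hx
      rw [isAlgebraic_iff_isIntegral]
      change IsIntegral K (m z)
      induction z using TensorProduct.induction_on with
      | zero => rw [map_zero]; exact isIntegral_zero
      | tmul r x =>
        rw [hm]
        refine IsIntegral.mul ?_ isIntegral_algebraMap
        have h1 : IsIntegral k (algebraMap κ F r) :=
          (Algebra.IsIntegral.isIntegral r).algebraMap
        exact h1.tower_top
      | add x y hx hy => rw [map_add]; exact hx.add hy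
    have hφ (b : B) : φB b ∈ R₀ := by
      refine AddSubmonoid.closure_induction (motive := fun b _ => φB b ∈ R₀) ?_ ?_ ?_ (H.span b)
      · rintro _ ⟨⟨r, a⟩, rfl⟩
        exact ⟨r ⊗ₜ φA a, by rw [map_mul, H.scalarB, H.comm]; exact hm _ _⟩
      · rw [map_zero]; exact zero_mem _
      · intro x y _ _ hx hy
        rw [map_add]; exact add_mem hx hy
    intro x
    obtain ⟨a, s, hs, rfl⟩ := hF x
    rw [div_eq_mul_inv]
    exact mul_mem (hφ a) (Subalgebra.inv_mem_of_algebraic R₀ (x := ⟨φB s, hφ s⟩) (halg _ (hφ s)))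
  refine ⟨?_⟩
  have e : (TensorProduct.lift (((Algebra.linearMap κ <| Module.End κ (K →ₗ[k] F)).flip
      (IsScalarTower.toAlgHom k K F).toLinearMap).restrictScalars k) : κ ⊗[k] K →ₗ[k] F) =
      m.toLinearMap := by
    refine TensorProduct.ext' fun r x => ?_
    rw [AlgHom.toLinearMap_apply, hm]
    simp [Algebra.smul_def]
  change Function.Bijective (TensorProduct.lift _ : κ ⊗[k] K →ₗ[k] F)
  rw [e]
  exact ⟨inj, surj⟩

end Pushout

/-- A point with values in a field factors through any affine chart that contains its image. -/
lemma exists_factor_of_mem_range {A L : Type u} [CommRing A] [Field L] {Y : Scheme.{u}}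
    (c : Spec (.of A) ⟶ Y) [IsOpenImmersion c] (p : Spec (.of L) ⟶ Y) (pt : Spec (.of L))
    (h : p pt ∈ Set.range c) :
    ∃ φ : A →+* L, Spec.map (CommRingCat.ofHom φ) ≫ c = p := by
  have hr : Set.range p ⊆ Set.range c := by
    rintro _ ⟨z, rfl⟩
    rwa [show z = pt from Subsingleton.elim (α := PrimeSpectrum L) _ _]
  obtain ⟨f, hf⟩ := Spec.map_surjective (IsOpenImmersion.lift c p hr)
  exact ⟨f.hom, by rw [CommRingCat.ofHom_hom, hf, IsOpenImmersion.lift_fac]⟩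

section ChartPairs

variable {k κ K F : Type u} [Field k] [Field κ] [Field K] [Field F] [Algebra k κ]
  {X P : Scheme.{u}} {q : X ⟶ P} {sX : X ⟶ Spec (.of κ)} {sP : P ⟶ Spec (.of k)}
  {ηX : Spec (.of F) ⟶ X} {ηP : Spec (.of K) ⟶ P} (hX : IsGenericPt ηX) (hP : IsGenericPt ηP)

include hX in
lemma ChartPair.exists_chartFn (S : ChartPair q sX sP) (y : Spec (.of S.B)) :
    ∃ φB : S.B →+* F, Spec.map (CommRingCat.ofHom φB) ≫ S.d = ηX := by
  have _ : Nontrivial S.B := by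
    by_contra h
    rw [not_nontrivial_iff_subsingleton] at h
    exact y.isPrime.ne_top (Subsingleton.elim _ _)
  exact Chatelet.exists_chartFn S.d hX

include hP in
lemma ChartPair.exists_chartFn' (S : ChartPair q sX sP) (y : Spec (.of S.B)) :
    ∃ φA : S.A →+* K, Spec.map (CommRingCat.ofHom φA) ≫ S.c = ηP := by
  have _ : Nontrivial S.B := by
    by_contra h
    rw [not_nontrivial_iff_subsingleton] at h
    exact y.isPrime.ne_top (Subsingleton.elim _ _)
  have _ : Nontrivial S.A := S.ι.domain_nontrivial
  exact Chatelet.exists_chartFn S.c hP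

section
variable [IsIntegral X] [IsIntegral P]
  (hq : IsPullback q sX sP (Spec.map (CommRingCat.ofHom (algebraMap k κ))))

include hX hP hq

lemma exists_functionField_map :
    ∃ g : K →+* F, Spec.map (CommRingCat.ofHom g) ≫ ηP = ηX ≫ q := by
  obtain ⟨S, y, -⟩ := exists_chartPair hq (genericPoint X)
  obtain ⟨φB, hB⟩ := S.exists_chartFn hX y
  obtain ⟨φA, hA⟩ := S.exists_chartFn' hP y
  have hinj : Function.Injective (φB.comp S.ι) :=
    (chartFn_injective hX hB).comp S.ι_injective
  have hAi := chartFn_injective hP hA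
  have _ : IsDomain S.A := hAi.isDomain φA
  let _ : Algebra S.A K := φA.toAlgebra
  have _ : FaithfulSMul S.A K := (faithfulSMul_iff_algebraMap_injective S.A K).2 hAi
  have hfr : IsFractionRing S.A K := IsFractionRing.of_field S.A K fun x => by
    obtain ⟨a, s, -, h⟩ := chartFn_frac hP hA x
    exact ⟨a, s, h⟩
  let g : K →+* F := IsFractionRing.lift hinj
  have hg : g.comp φA = φB.comp S.ι := 
    RingHom.ext fun a => IsFractionRing.lift_algebraMap hinj a
  refine ⟨g, ?_⟩
  rw [← hA, ← hB, Category.assoc, S.comm, ← Category.assoc, ← Category.assoc, ← Spec.map_comp,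
    ← Spec.map_comp, ← CommRingCat.ofHom_comp, ← CommRingCat.ofHom_comp, hg]

end

variable [Algebra k K] [Algebra κ F] [Algebra K F]
  (hsX : ηX ≫ sX = Spec.map (CommRingCat.ofHom (algebraMap κ F)))
  (hsP : ηP ≫ sP = Spec.map (CommRingCat.ofHom (algebraMap k K)))
  (hqη : Spec.map (CommRingCat.ofHom (algebraMap K F)) ≫ ηP = ηX ≫ q)

include hsX hsP hqη

lemma ChartPair.compatRings (S : ChartPair q sX sP) {φA : S.A →+* K} {φB : S.B →+* F}
    (hA : Spec.map (CommRingCat.ofHom φA) ≫ S.c = ηP)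
    (hB : Spec.map (CommRingCat.ofHom φB) ≫ S.d = ηX) :
    CompatRings k κ K F S.iA S.iB S.ι φA φB where
  scalarA r := by
    rw [← hA, Category.assoc, S.c_comp, ← Spec.map_comp] at hsP
    exact congr(($(Spec.map_injective hsP)).hom r)
  scalarB r := by
    rw [← hB, Category.assoc, S.d_comp, ← Spec.map_comp] at hsX
    exact congr(($(Spec.map_injective hsX)).hom r)
  comm a := by
    have h : φB.comp S.ι = (algebraMap K F).comp φA := by
      refine specMap_ext S.c ?_
      rw [CommRingCat.ofHom_comp, CommRingCat.ofHom_comp, Spec.map_comp, Spec.map_comp,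
        Category.assoc, Category.assoc, ← S.comm, hA, hqη, ← Category.assoc, hB]
    exact congr($h a)
  span := S.span

variable [IsIntegral X] [IsIntegral P]
  (hq : IsPullback q sX sP (Spec.map (CommRingCat.ofHom (algebraMap k κ))))
  [Algebra k F] [IsScalarTower k κ F]

include hq hX hP

omit [IsIntegral P] in
lemma isScalarTower_functionField : IsScalarTower k K F := by
  obtain ⟨S, y, -⟩ := exists_chartPair hq (genericPoint X)
  obtain ⟨φB, hB⟩ := S.exists_chartFn hX y
  obtain ⟨φA, hA⟩ := S.exists_chartFn' hP y
  have H := S.compatRings hsX hsP hqη hA hB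
  refine .of_algebraMap_eq fun r => ?_
  rw [← H.scalarA, ← H.comm, S.ι_iA, H.scalarB, ← IsScalarTower.algebraMap_apply]

omit [IsIntegral P] in
lemma isPushout_functionField [Algebra.IsAlgebraic k κ] [IsScalarTower k K F] :
    Algebra.IsPushout k κ K F := by
  obtain ⟨S, y, -⟩ := exists_chartPair hq (genericPoint X)
  obtain ⟨φB, hB⟩ := S.exists_chartFn hX y
  obtain ⟨φA, hA⟩ := S.exists_chartFn' hP y
  have H := S.compatRings hsX hsP hqη hA hB
  exact H.isPushout _ S.eq_zero (chartFn_injective hX hB) (chartFn_frac hP hA) (chartFn_frac hX hB)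

variable [IsScalarTower k K F] (h : Algebra.IsPushout k κ K F)
  (x₀ : Spec (.of k) ⟶ P) (hx₀ : x₀ ≫ sP = 𝟙 _) (y₀ : Spec (.of κ) ⟶ X) (hy₀ : y₀ ≫ sX = 𝟙 _)
  (hxy : y₀ ≫ q = Spec.map (CommRingCat.ofHom (algebraMap k κ)) ≫ x₀)

include hx₀ hy₀ hxy

omit [IsIntegral X] [IsIntegral P] in
lemma IsGood.coeffMap (pt : Spec (.of κ)) {D D' : Derivation κ F F} (lam : κ →ₗ[k] k)
    (hD' : ∀ x : K, D' (algebraMap K F x) = algebraMap K F (coeffMap h lam (D (algebraMap K F x))))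
    (hD : IsGood hX (y₀ pt) D) : IsGood hX (y₀ pt) D' := by
  constructor
  · intro x
    obtain ⟨S, y, rfl⟩ := exists_chartPair hq x
    obtain ⟨φB, hB⟩ := S.exists_chartFn hX y
    obtain ⟨φA, hA⟩ := S.exists_chartFn' hP y
    have H := S.compatRings hsX hsP hqη hA hB
    exact stalkFn_preserves hX hB (H.preserves h lam hD' (chartFn_preserves hX hB hD.1)) y
  · obtain ⟨S, y, hy⟩ := exists_chartPair hq (y₀ pt)
    obtain ⟨φB, hB⟩ := S.exists_chartFn hX y
    obtain ⟨φA, hA⟩ := S.exists_chartFn' hP y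
    have H := S.compatRings hsX hsP hqη hA hB
    obtain ⟨pB, hpB⟩ : ∃ pB : S.B →+* κ, Spec.map (CommRingCat.ofHom pB) ≫ S.d = y₀ :=
      exists_factor_of_mem_range S.d y₀ pt ⟨y, hy⟩
    obtain ⟨pA, hpA⟩ : ∃ pA : S.A →+* k, Spec.map (CommRingCat.ofHom pA) ≫ S.c = x₀ := by
      refine exists_factor_of_mem_range S.c x₀ (Spec.map (CommRingCat.ofHom (algebraMap k κ)) pt)
        ⟨Spec.map (CommRingCat.ofHom S.ι) y, ?_⟩
      rw [← Scheme.Hom.comp_apply, ← Scheme.Hom.comp_apply, ← S.comm, ← hxy,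
        Scheme.Hom.comp_apply, Scheme.Hom.comp_apply, hy]
    have hAc (r : k) : pA (S.iA r) = r := by
      rw [← hpA, Category.assoc, S.c_comp, ← Spec.map_comp, ← Spec.map_id] at hx₀
      exact congr(($(Spec.map_injective hx₀)).hom r)
    have hBc (r : κ) : pB (S.iB r) = r := by
      rw [← hpB, Category.assoc, S.d_comp, ← Spec.map_comp, ← Spec.map_id] at hy₀
      exact congr(($(Spec.map_injective hy₀)).hom r)
    have hABc (a : S.A) : pB (S.ι a) = algebraMap k κ (pA a) := by
      have e : pB.comp S.ι = (algebraMap k κ).comp pA := by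
        refine specMap_ext S.c ?_
        rw [CommRingCat.ofHom_comp, CommRingCat.ofHom_comp, Spec.map_comp, Spec.map_comp,
          Category.assoc, Category.assoc, ← S.comm, hpA, ← hxy, ← Category.assoc, hpB]
      exact congr($e a)
    have hker := H.ker_eq_map pA pB hAc hBc hABc S.ι_iA
    have hmax : (RingHom.ker pB).IsMaximal :=
      RingHom.ker_isMaximal_of_surjective _ fun r => ⟨S.iB r, hBc r⟩
    let z : Spec (.of S.B) := Spec.map (CommRingCat.ofHom pB) pt
    have hz : z.asIdeal = RingHom.ker pB := by
      have _ := pt.isPrime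
      have h1 : z.asIdeal = pt.asIdeal.comap pB := rfl
      rw [h1, Ideal.eq_bot_of_prime (K := κ) pt.asIdeal, RingHom.ker_eq_comap_bot]
    have hzpt : y₀ pt = S.d z := by
      rw [← hpB, Scheme.Hom.comp_apply]
    rw [hzpt] at hD ⊢
    obtain ⟨hD1, a, ha⟩ := hD
    have h1 := chartFn_scalarAt hX hB (a' := S.iB a) (H.scalarB a) z (hz ▸ hmax)
      (chartFn_preserves hX hB hD1) ha
    rw [hz, hker] at h1
    have h2 := H.scalarAt h lam hD' h1
    rw [← hker, ← hz] at h2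
    exact ⟨_, stalkFn_scalarAt hX hB z h2⟩

end ChartPairs

section RationalMap

variable {k κ : Type u} [Field k] [Field κ] [Algebra k κ] {n : ℕ}

open MvPolynomial in
theorem exists_rational_map [Algebra.IsAlgebraic k κ] {P : Scheme.{u}}
    {sP : P ⟶ Spec (.of k)} {q : Proj (stdGrading κ n) ⟶ P}
    (hq : IsPullback q (projToSpec κ n) sP (Spec.map (CommRingCat.ofHom (algebraMap k κ))))
    (x₀ : Spec (.of k) ⟶ P) (hx₀ : x₀ ≫ sP = 𝟙 _)
    (hxy : origin κ n ≫ q = Spec.map (CommRingCat.ofHom (algebraMap k κ)) ≫ x₀) :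
    ∃ (K F : Type u) (_ : Field K) (_ : Field F) (ηP : Spec (.of K) ⟶ P)
      (ηX : Spec (.of F) ⟶ Proj (stdGrading κ n)) (g : K →+* F)
      (v : Fin (n + 1) → Fin (n + 1) → κ),
      IsGenericPt ηP ∧ IsPullback (Spec.map (CommRingCat.ofHom g)) ηX ηP q ∧
      LinearIndependent κ v ∧
      ∀ (L : Fin (n + 1) → MvPolynomial (Fin (n + 1)) κ) (hL : ∀ i, L i ∈ stdGrading κ n 1)
        (h : ∀ i, X i ∈ Ideal.span (Set.range L)), (∀ i, L i = ∑ j, C (v i j) * X j) →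
        ∃ θ : Spec (.of K) ⟶ Proj (stdGrading k n),
          ηX ≫ linMap (algebraMap k κ) L hL h = Spec.map (CommRingCat.ofHom g) ≫ θ := by
  have _ : IsIntegral P := isIntegral_of_isPullback hq
  obtain ⟨K, _, ηP, hP⟩ := exists_isGenericPt P
  obtain ⟨F, _, ηX, hX⟩ := exists_isGenericPt (Proj (stdGrading κ n))
  obtain ⟨g, hg⟩ := exists_functionField_map hX hP hq
  obtain ⟨fP, hfP⟩ := Spec.map_surjective (ηP ≫ sP)
  obtain ⟨fX, hfX⟩ := Spec.map_surjective (ηX ≫ projToSpec κ n)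
  let _ : Algebra k K := fP.hom.toAlgebra
  let _ : Algebra κ F := fX.hom.toAlgebra
  let _ : Algebra K F := g.toAlgebra
  let _ : Algebra k F := ((algebraMap κ F).comp (algebraMap k κ)).toAlgebra
  have _ : IsScalarTower k κ F := .of_algebraMap_eq fun _ => rfl
  have hsP : ηP ≫ sP = Spec.map (CommRingCat.ofHom (algebraMap k K)) := hfP.symm
  have hsX : ηX ≫ projToSpec κ n = Spec.map (CommRingCat.ofHom (algebraMap κ F)) := hfX.symm
  have hqη : Spec.map (CommRingCat.ofHom (algebraMap K F)) ≫ ηP = ηX ≫ q := hg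
  have _ : IsScalarTower k K F := isScalarTower_functionField hX hP hsX hsP hqη hq
  have hpush : Algebra.IsPushout k κ K F := isPushout_functionField hX hP hsX hsP hqη hq
  obtain ⟨t, ht, hφ⟩ := exists_isCoordSystem hX hsX
  let pt : Spec (.of κ) := IsLocalRing.closedPoint κ
  obtain ⟨v, hv, hx⟩ := exists_rational_forms hpush ht (IsGood hX (origin κ n pt))
    (fun D hD => ((isGood_origin_iff hX ht hφ pt D).1 hD).exists_linForm ht.algInd)
    (fun D l hD => (isGood_origin_iff hX ht hφ pt D).2
      (ChartGood.of_linForm (fun i => ht.algInd.ne_zero i) hD))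
    (fun D D' lam hD hD' => IsGood.coeffMap hX hP hsX hsP hqη hq hpush x₀ hx₀ (origin κ n)
      (origin_toSpec κ n) hxy pt lam hD' hD)
  have hpb : IsPullback (Spec.map (CommRingCat.ofHom (algebraMap K F))) ηX ηP q := by
    refine IsPullback.of_bot ?_ hqη hq
    rw [hsX, hsP]
    exact isPullback_SpecMap_of_isPushout _ _ _ _
      ((CommRingCat.isPushout_iff_isPushout (R := k) (S := κ) (R' := K) (S' := F)).2 hpush.symm)
  refine ⟨K, F, _, _, ηP, ηX, g, v, hP, hpb, hv, fun L hL h hLv => ?_⟩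
  have hLe (i) : eval₂Hom (algebraMap κ F) (homCoord t) (L i) = linForm t (v i) := by
    simp [hLv, linForm]
  have h0 (j) : linForm t (v j) ≠ 0 :=
    fun e => hv.ne_zero j (linForm_eq_zero ht.algInd e)
  choose x hx using fun i => hx i 0
  refine ⟨Spec.map (CommRingCat.ofHom (eval₂Hom (algebraMap k K) fun i : Fin n =>
    x ((0 : Fin (n + 1)).succAbove i))) ≫ chartι k 0, ?_⟩
  have e : coordHom ((algebraMap κ F).comp (algebraMap k κ))
      (fun i => eval₂Hom (algebraMap κ F) (homCoord t) (L i)) 0 =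
      (algebraMap K F).comp (eval₂Hom (algebraMap k K) fun i : Fin n =>
        x ((0 : Fin (n + 1)).succAbove i)) := by
    refine MvPolynomial.ringHom_ext (fun r => ?_) fun i => ?_
    · simp only [coordHom, coe_eval₂Hom, eval₂_C, RingHom.comp_apply]
      rw [← IsScalarTower.algebraMap_apply, ← IsScalarTower.algebraMap_apply]
    · simp only [coordHom, coe_eval₂Hom, eval₂_X, RingHom.comp_apply]
      simp only [coe_eval₂Hom] at hLe
      rw [hLe, hLe, div_eq_iff (h0 0), hx]
  have h1 := coordHom_homCoord_comp ht hφ 0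
  have h2 := coordHom_chartι_linMap (algebraMap κ F) (homCoord t) (algebraMap k κ) L hL h 0 0
    (homCoord_ne_zero ht 0) ((hLe 0).symm ▸ h0 0)
  rw [e, CommRingCat.ofHom_comp, Spec.map_comp, Category.assoc] at h2
  rw [← h1, Category.assoc]
  exact h2

end RationalMap

section Descend

lemma IsGenericPt.isDominant {X : Scheme.{u}} {F : Type u} [Field F] {η : Spec (.of F) ⟶ X}
    (hη : IsGenericPt η) : IsDominant η := by
  refine ⟨fun x => ?_⟩
  obtain ⟨g, -, hg⟩ := hη.stalk x
  let pt : Spec (.of F) := IsLocalRing.closedPoint F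
  have h : η pt ∈ Set.range (X.fromSpecStalk x) := by
    rw [← hg, Scheme.Hom.comp_apply]
    exact ⟨_, rfl⟩
  rw [Scheme.range_fromSpecStalk] at h
  have h1 : η pt ∈ Set.range η := ⟨pt, rfl⟩
  exact closure_mono (Set.singleton_subset_iff.2 h1) (specializes_iff_mem_closure.1 h)

lemma ext_of_isSchemeTheoreticallyDominant {W Z Y : Scheme.{u}} {f g : Z ⟶ Y} [Y.IsSeparated]
    (w : W ⟶ Z) [IsSchemeTheoreticallyDominant w] (h : w ≫ f = w ≫ g) : f = g := by
  have hk : (equalizer.ι f g).ker = ⊥ := by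
    rw [← le_bot_iff, ← w.ker_eq_bot]
    conv_rhs => rw [← equalizer.lift_ι w h]
    exact Scheme.Hom.le_ker_comp _ _
  have _ := IsClosedImmersion.isIso_iff_ker_eq_bot.2 hk
  rw [← cancel_epi (equalizer.ι f g)]
  exact equalizer.condition f g

/-- A morphism out of a faithfully flat cover of an integral scheme descends if it descends
generically. -/
lemma exists_desc_of_generic {X P Y : Scheme.{u}} [IsIntegral P] [Y.IsSeparated] {K : Type u}
    [Field K] {q : X ⟶ P} [Flat q] [Surjective q] [QuasiCompact q] {ηP : Spec (.of K) ⟶ P}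
    [QuasiCompact ηP] (hP : IsGenericPt ηP) {T : Scheme.{u}} {a : T ⟶ Spec (.of K)} {b : T ⟶ X}
    (hpb : IsPullback a b ηP q) (r : X ⟶ Y) (θ : Spec (.of K) ⟶ Y) (h : b ≫ r = a ≫ θ) :
    ∃ ψ : P ⟶ Y, q ≫ ψ = r := by
  have _ := hP.isDominant
  have _ : IsSchemeTheoreticallyDominant ηP := .of_isDominant _
  have key : pullback.fst q q ≫ r = pullback.snd q q ≫ r := by
    refine ext_of_isSchemeTheoreticallyDominant
      (pullback.snd ηP (pullback.fst q q ≫ q)) ?_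
    have aux (p : pullback q q ⟶ X) (hp : p ≫ q = pullback.fst q q ≫ q) :
        pullback.snd ηP (pullback.fst q q ≫ q) ≫ p ≫ r =
          pullback.fst ηP (pullback.fst q q ≫ q) ≫ θ := by
      have e : pullback.fst ηP (pullback.fst q q ≫ q) ≫ ηP =
          (pullback.snd ηP (pullback.fst q q ≫ q) ≫ p) ≫ q := by
        rw [Category.assoc, hp]; exact pullback.condition
      rw [← Category.assoc, ← hpb.lift_snd _ _ e, Category.assoc, h, ← Category.assoc,
        hpb.lift_fst]
    rw [aux _ rfl, aux _ pullback.condition.symm]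
  refine ⟨EffectiveEpi.desc q r fun g₁ g₂ hg => ?_, EffectiveEpi.fac q r _⟩
  rw [← pullback.lift_fst g₁ g₂ hg, Category.assoc, key, ← Category.assoc, pullback.lift_snd]

end Descend

section LinearForms

open MvPolynomial

variable {κ : Type u} [Field κ] {n : ℕ}

/-- The linear forms given by the rows of a matrix. -/
def matrixForms (M : Matrix (Fin (n + 1)) (Fin (n + 1)) κ) (i : Fin (n + 1)) :
    MvPolynomial (Fin (n + 1)) κ :=
  ∑ j, C (M i j) * X j

lemma matrixForms_mem (M : Matrix (Fin (n + 1)) (Fin (n + 1)) κ) (i : Fin (n + 1)) :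
    matrixForms M i ∈ stdGrading κ n 1 :=
  Submodule.sum_mem _ fun j _ => by
    rw [← smul_eq_C_mul]
    exact Submodule.smul_mem _ _ (X_mem κ n j)

lemma linSubst_matrixForms {M N : Matrix (Fin (n + 1)) (Fin (n + 1)) κ} (h : N * M = 1)
    (i : Fin (n + 1)) :
    linSubst (RingHom.id κ) (matrixForms M) (matrixForms_mem M) (matrixForms N i) = X i := by
  have h1 : linSubst (RingHom.id κ) (matrixForms M) (matrixForms_mem M) (matrixForms N i) =
      ∑ j, C (N i j) * matrixForms M j := by
    rw [matrixForms, map_sum]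
    simp
  rw [h1]
  simp_rw [matrixForms, Finset.mul_sum, ← mul_assoc, ← C_mul]
  rw [Finset.sum_comm]
  simp_rw [← Finset.sum_mul, ← map_sum, ← Matrix.mul_apply, h, Matrix.one_apply]
  simp

end LinearForms

section Main

variable {k κ : Type u} [Field k] [Field κ] [Algebra k κ] {n : ℕ}

theorem exists_iso_of_section [Algebra.IsAlgebraic k κ] {P : Scheme.{u}}
    {sP : P ⟶ Spec (.of k)} [QuasiSeparated sP] {q : Proj (stdGrading κ n) ⟶ P}
    (hq : IsPullback q (projToSpec κ n) sP (Spec.map (CommRingCat.ofHom (algebraMap k κ))))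
    (x₀ : Spec (.of k) ⟶ P) (hx₀ : x₀ ≫ sP = 𝟙 _)
    (hxy : origin κ n ≫ q = Spec.map (CommRingCat.ofHom (algebraMap k κ)) ≫ x₀) :
    ∃ e : P ≅ Proj (stdGrading k n), e.hom ≫ projToSpec k n = sP := by
  obtain ⟨K, F, _, _, ηP, ηX, g, v, hP, hpb, hv, H⟩ := exists_rational_map hq x₀ hx₀ hxy
  have _ : IsIntegral P := isIntegral_of_isPullback hq
  have _ := surjective_of_isPullback hq
  have _ := flat_of_isPullback hq
  have _ := quasiCompact_of_isPullback hq
  have _ : QuasiCompact (ηP ≫ sP) := inferInstance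
  have _ : QuasiCompact ηP := .of_comp ηP sP
  let M : Matrix (Fin (n + 1)) (Fin (n + 1)) κ := Matrix.of v
  have hM : IsUnit M := Matrix.linearIndependent_rows_iff_isUnit.1 hv
  have hdet := (Matrix.isUnit_iff_isUnit_det M).1 hM
  have e1 := linSubst_matrixForms (Matrix.nonsing_inv_mul M hdet)
  have e2 := linSubst_matrixForms (Matrix.mul_nonsing_inv M hdet)
  have hspan := X_mem_span_of_linSubst (matrixForms_mem M) _ (matrixForms_mem M⁻¹) e1
  have hr := isPullback_linMap (algebraMap k κ) _ _ (matrixForms_mem M) (matrixForms_mem M⁻¹)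
    hspan e1 e2
  obtain ⟨θ, hθ⟩ := H _ (matrixForms_mem M) hspan fun i => rfl
  obtain ⟨ψ, hψ⟩ := exists_desc_of_generic hP hpb _ θ hθ
  have hepi : Epi q := inferInstance
  have hψs : ψ ≫ projToSpec k n = sP := by
    rw [← cancel_epi q, ← Category.assoc, hψ, hr.w, hq.w]
  have hpb' : IsPullback q (𝟙 _) ψ (linMap (algebraMap k κ) _ (matrixForms_mem M) hspan) := by
    refine IsPullback.of_bot (v₂₁ := projToSpec κ n) (v₂₂ := projToSpec k n) ?_ ?_ hr
    · rw [Category.id_comp, hψs]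
      exact hq
    · rw [hψ, Category.id_comp]
  have _ := surjective_of_isPullback hr
  have _ := flat_of_isPullback hr
  have _ := quasiCompact_of_isPullback hr
  have hiso : MorphismProperty.isomorphisms Scheme.{u} ψ :=
    MorphismProperty.of_isPullback_of_descendsAlong
      (Q := @Surjective ⊓ @Flat ⊓ @QuasiCompact) hpb'.flip
      ⟨⟨inferInstance, inferInstance⟩, inferInstance⟩
      (inferInstanceAs (IsIso (𝟙 (Proj (stdGrading κ n)))))
  have _ : IsIso ψ := hiso
  exact ⟨asIso ψ, hψs⟩

theorem iff_of_isPullback [Algebra.IsAlgebraic k κ] {P : Scheme.{u}}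
    {sP : P ⟶ Spec (.of k)} [QuasiSeparated sP] {q : Proj (stdGrading κ n) ⟶ P}
    (hq : IsPullback q (projToSpec κ n) sP (Spec.map (CommRingCat.ofHom (algebraMap k κ)))) :
    (∃ e : P ≅ Proj (stdGrading k n), e.hom ≫ projToSpec k n = sP) ↔
      ∃ x : Spec (.of k) ⟶ P, x ≫ sP = 𝟙 _ := by
  constructor
  · rintro ⟨e, rfl⟩
    exact ⟨origin k n ≫ e.inv, by rw [Category.assoc, e.inv_hom_id_assoc, origin_toSpec]⟩
  · rintro ⟨x, hx⟩
    have hw : (Spec.map (CommRingCat.ofHom (algebraMap k κ)) ≫ x) ≫ sP =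
        𝟙 _ ≫ Spec.map (CommRingCat.ofHom (algebraMap k κ)) := by
      rw [Category.assoc, hx, Category.comp_id, Category.id_comp]
    obtain ⟨σ, hσ, hp⟩ := exists_iso_origin (hq.lift _ _ hw) (hq.lift_snd _ _ hw)
    refine exists_iso_of_section (q := σ.hom ≫ q) ?_ x hx ?_
    · refine hq.of_iso σ.symm (Iso.refl _) (Iso.refl _) (Iso.refl _) ?_ ?_ ?_ ?_
      · rw [Iso.refl_hom, Category.comp_id, Iso.symm_hom, σ.inv_hom_id_assoc]
      · rw [Iso.refl_hom, Category.comp_id, Iso.symm_hom, ← hσ, σ.inv_hom_id_assoc, hσ]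
      · rw [Iso.refl_hom, Iso.refl_hom, Category.comp_id, Category.id_comp]
      · rw [Iso.refl_hom, Iso.refl_hom, Category.comp_id, Category.id_comp]
    · rw [← Category.assoc, hp, hq.lift_fst]

end Main

theorem iff_of_isSeveriBrauer {k : Type u} [Field k] {P : Scheme.{u}}
    {sP : P ⟶ Spec (.of k)} {n : ℕ} (h : IsSeveriBrauer sP n) :
    (∃ e : P ≅ Proj (stdGrading k n), e.hom ≫ projToSpec k n = sP) ↔
      ∃ x : Spec (.of k) ⟶ P, x ≫ sP = 𝟙 _ := by
  have _ := h.proper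
  obtain ⟨e, he⟩ : ∃ e : pullback sP (Spec.map (CommRingCat.ofHom
      (algebraMap k (AlgebraicClosure k)))) ≅ Proj (stdGrading (AlgebraicClosure k) n),
      e.hom ≫ projToSpec (AlgebraicClosure k) n = pullback.snd _ _ := h.exists_iso
  have h1 : IsPullback (pullback.fst sP (Spec.map (CommRingCat.ofHom
      (algebraMap k (AlgebraicClosure k))))) (pullback.snd _ _) sP _ := .of_hasPullback _ _
  refine iff_of_isPullback (κ := AlgebraicClosure k) (q := e.inv ≫ pullback.fst _ _) ?_
  have h2 : e.inv ≫ pullback.snd sP (Spec.map (CommRingCat.ofHom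
      (algebraMap k (AlgebraicClosure k)))) = projToSpec (AlgebraicClosure k) n :=
    e.inv_comp_eq.2 he.symm
  refine h1.of_iso e (Iso.refl _) (Iso.refl _) (Iso.refl _) ?_ ?_ ?_ ?_
  · rw [Iso.refl_hom, Category.comp_id, e.hom_inv_id_assoc]
  · rw [Iso.refl_hom, Category.comp_id, ← h2, e.hom_inv_id_assoc]
  · rw [Iso.refl_hom, Iso.refl_hom, Category.comp_id, Category.id_comp]
  · rw [Iso.refl_hom, Iso.refl_hom, Category.comp_id, Category.id_comp]

end Chatelet

/-- Châtelet's theorem.  A Severi–Brauer variety `P` of dimension `n` over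
`k` is isomorphic to `ℙⁿ_k` over `k` iff it has a `k`-rational point. -/
theorem chatelet_theorem {k : Type u} [Field k] {P : Scheme.{u}}
    (sP : P ⟶ Spec (CommRingCat.of k)) (n : ℕ) (hSB : IsSeveriBrauer sP n) :
    (∃ e : P ≅ ProjectiveSpace k n, e.hom ≫ ProjectiveSpace.toSpec k n = sP) ↔
      (∃ x : Spec (CommRingCat.of k) ⟶ P, x ≫ sP = 𝟙 _) :=
  Chatelet.iff_of_isSeveriBrauer hSB
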